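/- For every ε > 0 there exists a constant C(ε) > 0 such that for every odd prime p and every real x ≥ 2, the number of square-full positive integers m ≤ x with gcd(m,p) = 1 equals (L(3/2, χ₀)/ζ(3)) · (1 + 1/p + 1/p²)^{-1} · x^{1/2} + (ζ(2/3)/ζ(2)) · ((1 − p^{−2/3})/(1 + p^{−1})) · x^{1/3} + E, where |E| ≤ C(ε) · x^{1/6+ε} · p^{ε}. Here L(3/2, χ₀) = ζ(3/2) · (1 − p^{−3/2}) is the value at s = 3/2 of the Dirichlet L-function of the principal character χ₀ modulo p. -/

import Mathlib

/-- A positive integer `n` is square-full if every prime `q` dividing `n` satisfies `q^2 ∣ n`. -/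
def Squarefull (n : ℕ) : Prop := ∀ q : ℕ, q.Prime → q ∣ n → q ^ 2 ∣ n

section ZetaPartialSums

open Filter Topology

lemma hasDerivAt_ofReal_cpow_of_pos (c : ℂ) {t : ℝ} (ht : 0 < t) :
    HasDerivAt (fun y : ℝ => (y : ℂ) ^ c) (c * (t : ℂ) ^ (c - 1)) t := by
  have h : HasDerivAt (fun z : ℂ => z ^ c) (c * (t : ℂ) ^ (c - 1)) (t : ℂ) := by
    have := (hasDerivAt_id (t : ℂ)).cpow_const (c := c) (by simp [Complex.mem_slitPlane_iff, ht])
    simpa using this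
  exact h.comp_ofReal

/-- Local term of the Euler–Maclaurin expansion of `(s - 1) ζ(s)`. -/
noncomputable def zetaTerm (n : ℕ) (s : ℂ) : ℂ :=
  (s - 1) * ((n + 1 : ℕ) : ℂ) ^ (-s) + ((n + 2 : ℕ) : ℂ) ^ (1 - s) - ((n + 1 : ℕ) : ℂ) ^ (1 - s)

lemma norm_cpow_neg_sub_le {a : ℝ} (ha : 0 < a) {s : ℂ} (hs : 0 < s.re) {t : ℝ} (ht : a ≤ t) :
    ‖(t : ℂ) ^ (-s) - (a : ℂ) ^ (-s)‖ ≤ ‖s‖ * a ^ (-s.re - 1) * (t - a) := by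
  refine norm_image_sub_le_of_norm_deriv_le_segment' (f := fun y : ℝ => (y : ℂ) ^ (-s))
    (f' := fun y : ℝ => (-s) * (y : ℂ) ^ (-s - 1)) (b := t) ?_ ?_ t ⟨ht, le_rfl⟩
  · intro x hx
    exact (hasDerivAt_ofReal_cpow_of_pos _ (ha.trans_le hx.1)).hasDerivWithinAt
  · intro x hx
    rw [norm_mul, norm_neg, Complex.norm_cpow_eq_rpow_re_of_pos (ha.trans_le hx.1)]
    gcongr
    simp only [Complex.sub_re, Complex.neg_re, Complex.one_re]
    exact Real.rpow_le_rpow_of_nonpos ha hx.1 (by linarith)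

lemma norm_zetaTerm_le (n : ℕ) {s : ℂ} (hs : 0 < s.re) :
    ‖zetaTerm n s‖ ≤ ‖1 - s‖ * ‖s‖ * ((n + 1 : ℕ) : ℝ) ^ (-s.re - 1) := by
  set a : ℝ := ((n + 1 : ℕ) : ℝ) with ha
  have ha0 : 0 < a := by positivity
  have key := norm_image_sub_le_of_norm_deriv_le_segment'
    (f := fun y : ℝ => (y : ℂ) ^ (1 - s) - (1 - s) * (a : ℂ) ^ (-s) * y)
    (f' := fun y : ℝ => (1 - s) * ((y : ℂ) ^ (-s) - (a : ℂ) ^ (-s)))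
    (C := ‖1 - s‖ * (‖s‖ * a ^ (-s.re - 1))) (a := a) (b := a + 1) ?_ ?_ (a + 1)
    ⟨by linarith, le_rfl⟩
  · have e : zetaTerm n s = (((a + 1 : ℝ) : ℂ) ^ (1 - s) - (1 - s) * (a : ℂ) ^ (-s) * (a + 1 : ℝ))
        - ((a : ℂ) ^ (1 - s) - (1 - s) * (a : ℂ) ^ (-s) * a) := by
      simp only [zetaTerm, ha]
      push_cast
      ring_nf
    rw [e]
    simpa [mul_assoc] using key
  · intro x hx
    have h1 := hasDerivAt_ofReal_cpow_of_pos (1 - s) (ha0.trans_le hx.1)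
    have h2 : HasDerivAt (fun y : ℝ => (1 - s) * (a : ℂ) ^ (-s) * (y : ℂ))
        ((1 - s) * (a : ℂ) ^ (-s)) x := by
      simpa using (Complex.ofRealCLM.hasDerivAt (x := x)).const_mul ((1 - s) * (a : ℂ) ^ (-s))
    have h3 := h1.sub h2
    refine (h3.congr_deriv ?_).hasDerivWithinAt
    rw [show (1 - s - 1) = -s by ring]
    ring
  · intro x hx
    rw [norm_mul]
    gcongr
    refine (norm_cpow_neg_sub_le ha0 hs hx.1).trans ?_
    refine mul_le_of_le_one_right (by positivity) (by linarith [hx.2])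

lemma summable_nat_succ_rpow {r : ℝ} (hr : r < -1) :
    Summable (fun n : ℕ => ((n + 1 : ℕ) : ℝ) ^ r) :=
  (summable_nat_add_iff 1).2 (Real.summable_nat_rpow.2 hr)

lemma differentiable_zetaTerm (n : ℕ) : Differentiable ℂ (zetaTerm n) := by
  unfold zetaTerm
  intro s
  have h (k : ℕ) : ((k + 1 : ℕ) : ℂ) ≠ 0 := by exact_mod_cast Nat.succ_ne_zero k
  have h1 := h n
  have h2 := h (n + 1)
  fun_prop (disch := simp_all)

lemma sum_zetaTerm (N : ℕ) (s : ℂ) : ∑ n ∈ Finset.range N, zetaTerm n s =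
    (s - 1) * ∑ n ∈ Finset.range N, ((n + 1 : ℕ) : ℂ) ^ (-s) + ((N + 1 : ℕ) : ℂ) ^ (1 - s) - 1 := by
  induction N with
  | zero => simp
  | succ N ih => rw [Finset.sum_range_succ, ih, Finset.sum_range_succ, zetaTerm]; ring

lemma summable_zetaTerm {s : ℂ} (hs : 0 < s.re) : Summable (fun n => zetaTerm n s) :=
  Summable.of_norm_bounded ((summable_nat_succ_rpow (by linarith)).mul_left _)
    (fun n => norm_zetaTerm_le n hs)

lemma tsum_zetaTerm_of_one_lt {s : ℂ} (hs : 1 < s.re) :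
    ∑' n, zetaTerm n s = (s - 1) * riemannZeta s - 1 := by
  refine tendsto_nhds_unique (summable_zetaTerm (by linarith)).hasSum.tendsto_sum_nat ?_
  simp only [sum_zetaTerm]
  have h1 : Tendsto (fun N => ∑ n ∈ Finset.range N, ((n + 1 : ℕ) : ℂ) ^ (-s)) atTop
      (𝓝 (riemannZeta s)) := by
    have := (LSeriesHasSum_one hs)
    unfold LSeriesHasSum at this
    have h2 := ((hasSum_nat_add_iff' 1).2 this).tendsto_sum_nat
    simp only [Finset.range_one, Finset.sum_singleton, LSeries.term_zero, sub_zero] at h2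
    refine h2.congr fun N => Finset.sum_congr rfl fun n _ => ?_
    rw [LSeries.term_of_ne_zero (Nat.succ_ne_zero n), Complex.cpow_neg]
    simp
  have h2 : Tendsto (fun N : ℕ => ((N + 1 : ℕ) : ℂ) ^ (1 - s)) atTop (𝓝 0) := by
    rw [tendsto_zero_iff_norm_tendsto_zero]
    have h3 : Tendsto (fun N : ℕ => ((N + 1 : ℕ) : ℝ) ^ (-(s.re - 1))) atTop (𝓝 0) :=
      ((tendsto_rpow_neg_atTop (by linarith : 0 < s.re - 1)).comp tendsto_natCast_atTop_atTop).comp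
        (tendsto_add_atTop_nat 1)
    refine h3.congr fun N => ?_
    rw [Complex.norm_natCast_cpow_of_pos (Nat.succ_pos N)]
    simp
  simpa using ((h1.const_mul (s - 1)).add h2).sub_const 1

lemma tsum_zetaTerm {s : ℂ} (hs : 0 < s.re) :
    ∑' n, zetaTerm n s = riemannZeta₁ s - 1 := by
  set σ := s.re / 2 with hσ
  set R := ‖s‖ + 3 + σ with hR
  have hσ0 : 0 < σ := by positivity
  set U : Set ℂ := {z | σ < z.re} ∩ Metric.ball 0 R with hU
  have hUo : IsOpen U := (isOpen_lt continuous_const Complex.continuous_re).inter Metric.isOpen_ball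
  have hUc : IsPreconnected U :=
    ((convex_halfSpace_re_gt σ).inter (convex_ball 0 R)).isPreconnected
  have hd : DifferentiableOn ℂ (fun w => ∑' n, zetaTerm n w) U := by
    refine Complex.differentiableOn_tsum_of_summable_norm (u := fun n : ℕ =>
      (1 + R) * R * ((n + 1 : ℕ) : ℝ) ^ (-σ - 1))
      ((summable_nat_succ_rpow (by linarith)).mul_left _)
      (fun n => (differentiable_zetaTerm n).differentiableOn) hUo ?_
    rintro n w ⟨hw1, hw2⟩
    have hw1 : σ < w.re := hw1
    have hw2 : ‖w‖ ≤ R := by simpa using (Metric.mem_ball.1 hw2).le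
    refine (norm_zetaTerm_le n (hσ0.trans hw1)).trans ?_
    have h3 : ‖1 - w‖ ≤ 1 + R := (norm_sub_le _ _).trans (by simpa using hw2)
    gcongr
    norm_cast
    omega
  have hd2 : DifferentiableOn ℂ (fun w => riemannZeta₁ w - 1) U := by
    fun_prop
  set z0 : ℂ := ((2 + σ : ℝ) : ℂ)
  have hz0 : z0 ∈ U := by
    constructor
    · change σ < z0.re
      simp only [z0, Complex.ofReal_re]; linarith
    · rw [mem_ball_zero_iff, Complex.norm_real, Real.norm_eq_abs, abs_of_pos (by positivity)]
      have := norm_nonneg s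
      linarith
  have hs' : s ∈ U := by
    constructor
    · change σ < s.re
      linarith
    · rw [mem_ball_zero_iff]; linarith
  have := (hd.analyticOnNhd hUo).eqOn_of_preconnected_of_eventuallyEq (hd2.analyticOnNhd hUo)
    hUc hz0 ?_
  · exact this hs'
  · have : {z : ℂ | 1 < z.re} ∈ 𝓝 z0 :=
      (isOpen_lt continuous_const Complex.continuous_re).mem_nhds (by simp [z0]; linarith)
    filter_upwards [this] with w hw
    have hw : 1 < w.re := hw
    rw [tsum_zetaTerm_of_one_lt hw, riemannZeta_eq_inv_sub_mul (by rintro rfl; simp at hw)]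
    have : w - 1 ≠ 0 := sub_ne_zero.2 (by rintro rfl; simp at hw)
    field_simp

lemma tendsto_sum_rpow_sub {s : ℝ} (hs : 0 < s) (hs1 : s ≠ 1) :
    Tendsto (fun N : ℕ => ((∑ n ∈ Finset.range N, ((n + 1 : ℕ) : ℝ) ^ (-s)
      - ((N + 1 : ℕ) : ℝ) ^ (1 - s) / (1 - s) : ℝ) : ℂ)) atTop (𝓝 (riemannZeta s)) := by
  have h := (summable_zetaTerm (s := s) (by simpa)).hasSum.tendsto_sum_nat
  rw [tsum_zetaTerm (by simpa)] at h
  have hne : (s : ℂ) - 1 ≠ 0 := sub_ne_zero.2 (by exact_mod_cast hs1)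
  have h2 := (h.add_const 1).const_mul (((s : ℂ) - 1)⁻¹)
  rw [sub_add_cancel, ← riemannZeta_eq_inv_sub_mul (by exact_mod_cast hs1)] at h2
  refine h2.congr fun N => ?_
  have hne' : 1 - (s : ℂ) ≠ 0 := by rw [← neg_sub]; exact neg_ne_zero.2 hne
  rw [sum_zetaTerm]
  have e (k : ℕ) (r : ℝ) : (((k : ℝ) ^ r : ℝ) : ℂ) = (k : ℂ) ^ (r : ℂ) := by
    rw [Complex.ofReal_cpow (by positivity)]; simp
  rw [Complex.ofReal_sub, Complex.ofReal_sum, Complex.ofReal_div, e]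
  simp only [e]
  push_cast
  field_simp
  ring

lemma trapezoid_rpow_error {s : ℝ} (hs : 0 < s) (hs1 : s ≠ 1) {k : ℝ} (hk : 0 < k) :
    |((k + 1) ^ (-s) + k ^ (-s)) / 2 - ((k + 1) ^ (1 - s) - k ^ (1 - s)) / (1 - s)|
      ≤ s * (s + 1) * k ^ (-s - 2) := by
  have hd (r : ℝ) {x : ℝ} (hx : 0 < x) : HasDerivAt (fun y : ℝ => y ^ r) (r * x ^ (r - 1)) x :=
    Real.hasDerivAt_rpow_const (Or.inl hx.ne')
  have hne : 1 - s ≠ 0 := sub_ne_zero.2 hs1.symm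
  have hmono {x : ℝ} (hx : k ≤ x) : x ^ (-s - 2) ≤ k ^ (-s - 2) :=
    Real.rpow_le_rpow_of_nonpos hk hx (by linarith)
  have hder : ∀ x ∈ Set.Icc k (k + 1),
      ‖(k ^ (-s) - x ^ (-s)) / 2 - (x - k) * (s * x ^ (-s - 1)) / 2‖
        ≤ s * (s + 1) * k ^ (-s - 2) := by
    intro x hx
    have key := norm_image_sub_le_of_norm_deriv_le_segment'
      (f := fun x : ℝ => (k ^ (-s) - x ^ (-s)) / 2 - (x - k) * (s * x ^ (-s - 1)) / 2)
      (f' := fun x : ℝ => (x - k) * (s * (s + 1) * x ^ (-s - 2)) / 2)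
      (C := s * (s + 1) * k ^ (-s - 2)) (a := k) (b := k + 1) ?_ ?_ x hx
    · simp only [sub_self, zero_div, zero_mul, sub_zero] at key
      refine key.trans (mul_le_of_le_one_right (by positivity) (by linarith [hx.2]))
    · intro y hy
      have hy0 := hk.trans_le hy.1
      have h1 := ((hd (-s) hy0).const_sub (k ^ (-s))).div_const 2
      have h2 := ((((hasDerivAt_id y).sub_const k).mul
        ((hd (-s - 1) hy0).const_mul s))).div_const 2
      refine ((h1.sub h2).congr_deriv ?_).hasDerivWithinAt
      simp only [id]
      rw [show -s - 1 - 1 = -s - 2 by ring]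
      ring
    · intro y hy
      have hy0 := hk.trans_le hy.1
      have := hmono hy.1
      have h3 : 0 < y ^ (-s - 2) := by positivity
      have h4 := hy.2
      have h5 := hy.1
      rw [Real.norm_eq_abs, abs_of_nonneg (by
        have : 0 ≤ y - k := by linarith
        positivity)]
      have : (y - k) * (s * (s + 1) * y ^ (-s - 2)) ≤ 1 * (s * (s + 1) * k ^ (-s - 2)) := by
        gcongr
        linarith
      have : 0 ≤ s * (s + 1) * k ^ (-s - 2) := by positivity
      linarith
  have key := norm_image_sub_le_of_norm_deriv_le_segment'
    (f := fun x : ℝ => (x - k) * (x ^ (-s) + k ^ (-s)) / 2 - x ^ (1 - s) / (1 - s))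
    (f' := fun x : ℝ => (k ^ (-s) - x ^ (-s)) / 2 - (x - k) * (s * x ^ (-s - 1)) / 2)
    (C := s * (s + 1) * k ^ (-s - 2)) (a := k) (b := k + 1) ?_ ?_ (k + 1)
    ⟨by linarith, le_rfl⟩
  · rw [Real.norm_eq_abs] at key
    convert key using 1
    · congr 1
      ring
    · ring
  · intro x hx
    have hx0 := hk.trans_le hx.1
    have h1 := ((((hasDerivAt_id x).sub_const k).mul
        ((hd (-s) hx0).add_const (k ^ (-s))))).div_const 2
    have h2 := (hd (1 - s) hx0).div_const (1 - s)
    refine ((h1.sub h2).congr_deriv ?_).hasDerivWithinAt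
    simp only [id]
    rw [show 1 - s - 1 = -s by ring]
    field_simp
    ring
  · intro x hx
    exact hder x ⟨hx.1, hx.2.le⟩

lemma rpow_neg_sub_two_le_telescope {s : ℝ} (hs : 0 < s) {k : ℝ} (hk : 1 ≤ k) :
    k ^ (-s - 2) ≤ 2 ^ (s + 2) * (k ^ (-s - 1) - (k + 1) ^ (-s - 1)) := by
  have hk0 : 0 < k := by linarith
  have h := Convex.mul_sub_le_image_sub_of_le_deriv (convex_Icc k (k + 1))
    (f := fun x : ℝ => - x ^ (-s - 1)) (C := (2 * k) ^ (-s - 2)) ?_ ?_ ?_ k ⟨le_rfl, by linarith⟩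
    (k + 1) ⟨by linarith, le_rfl⟩ (by linarith)
  · have h2 : (2 : ℝ) ^ (s + 2) * (2 * k) ^ (-s - 2) = k ^ (-s - 2) := by
      rw [Real.mul_rpow (by norm_num) hk0.le, ← mul_assoc, ← Real.rpow_add (by norm_num)]
      norm_num
    rw [← h2]
    gcongr
    linarith
  · refine ContinuousOn.neg (ContinuousOn.rpow_const continuousOn_id ?_)
    intro x hx
    exact Or.inl (hk0.trans_le hx.1).ne'
  · intro x hx
    have hx0 : 0 < x := hk0.trans_le (interior_subset hx).1
    exact (Real.hasDerivAt_rpow_const (Or.inl hx0.ne')).neg.differentiableAt.differentiableWithinAt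
  · intro x hx
    have hx' := interior_subset hx
    have hx0 : 0 < x := hk0.trans_le hx'.1
    have hd : HasDerivAt (fun x : ℝ => -x ^ (-s - 1)) (-((-s - 1) * x ^ (-s - 1 - 1))) x :=
      (Real.hasDerivAt_rpow_const (Or.inl hx0.ne')).neg
    rw [hd.deriv, show -s - 1 - 1 = -s - 2 by ring]
    have h1 : (2 * k) ^ (-s - 2) ≤ x ^ (-s - 2) :=
      Real.rpow_le_rpow_of_nonpos hx0 (by linarith [hx'.2]) (by linarith)
    have h2 : 0 < x ^ (-s - 2) := by positivity
    nlinarith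

lemma sum_Icc_one_eq_sum_range {M : Type*} [AddCommMonoid M] (g : ℕ → M) (N : ℕ) :
    ∑ n ∈ Finset.Icc 1 N, g n = ∑ n ∈ Finset.range N, g (n + 1) := by
  induction N with
  | zero => simp
  | succ N ih => rw [Finset.sum_Icc_succ_top (by omega), ih, Finset.sum_range_succ]

/-- Partial sums of `ζ(s)` for real `0 < s ≠ 1`, with two main terms. -/
lemma exists_zeta_partial_sum_bound {s : ℝ} (hs : 0 < s) (hs1 : s ≠ 1) :
    ∃ z : ℝ, riemannZeta s = z ∧ ∃ C : ℝ, 0 < C ∧ ∀ K : ℕ, 1 ≤ K →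
      |∑ n ∈ Finset.Icc 1 K, (n : ℝ) ^ (-s) - z - (K : ℝ) ^ (1 - s) / (1 - s) - (K : ℝ) ^ (-s) / 2|
        ≤ C * (K : ℝ) ^ (-s - 1) := by
  have hlim := tendsto_sum_rpow_sub hs hs1
  have hre := (Complex.continuous_re.tendsto _).comp hlim
  have him := (Complex.continuous_im.tendsto _).comp hlim
  have him0 : (riemannZeta s).im = 0 := by
    refine tendsto_nhds_unique him ?_
    simp only [Function.comp_def, Complex.ofReal_im]
    exact tendsto_const_nhds
  set z := (riemannZeta s).re with hz
  refine ⟨z, Complex.ext (by simp [hz]) (by simp [him0]), ?_⟩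
  set a : ℕ → ℝ := fun K => ∑ n ∈ Finset.Icc 1 K, (n : ℝ) ^ (-s) - (K : ℝ) ^ (1 - s) / (1 - s)
    - (K : ℝ) ^ (-s) / 2 with ha
  have hneg : Tendsto (fun N : ℕ => ((N + 1 : ℕ) : ℝ) ^ (-s)) atTop (𝓝 0) :=
    ((tendsto_rpow_neg_atTop hs).comp tendsto_natCast_atTop_atTop).comp (tendsto_add_atTop_nat 1)
  have halim : Tendsto a atTop (𝓝 z) := by
    rw [← tendsto_add_atTop_iff_nat 1]
    have h1 := hre.add (hneg.div_const 2)
    simp only [zero_div, add_zero] at h1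
    refine h1.congr fun N => ?_
    simp only [Function.comp_def, Complex.ofReal_re, ha]
    rw [Finset.sum_Icc_succ_top (by omega), sum_Icc_one_eq_sum_range]
    ring
  set C := s * (s + 1) * 2 ^ (s + 2) with hC
  have hstep (K : ℕ) (hK : 1 ≤ K) : |a (K + 1) - a K| ≤
      C * ((K : ℝ) ^ (-s - 1) - ((K + 1 : ℕ) : ℝ) ^ (-s - 1)) := by
    have hK' : (1 : ℝ) ≤ K := by exact_mod_cast hK
    have h1 := trapezoid_rpow_error hs hs1 (k := K) (by linarith)
    have h2 := rpow_neg_sub_two_le_telescope hs hK'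
    have e : a (K + 1) - a K = (((K : ℝ) + 1) ^ (-s) + (K : ℝ) ^ (-s)) / 2
        - (((K : ℝ) + 1) ^ (1 - s) - (K : ℝ) ^ (1 - s)) / (1 - s) := by
      simp only [ha]
      rw [Finset.sum_Icc_succ_top (by omega)]
      push_cast
      ring
    rw [e]
    refine h1.trans ?_
    push_cast
    rw [hC, mul_assoc (s * (s + 1))]
    gcongr
  have hC0 : 0 < C := by positivity
  refine ⟨C, hC0, fun K hK => ?_⟩
  have hfar (j : ℕ) : |a (K + j) - a K| ≤
      C * ((K : ℝ) ^ (-s - 1) - ((K + j : ℕ) : ℝ) ^ (-s - 1)) := by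
    induction j with
    | zero => simp
    | succ j ih =>
      have h1 := hstep (K + j) (by omega)
      calc |a (K + (j + 1)) - a K| = |(a (K + j + 1) - a (K + j)) + (a (K + j) - a K)| := by
            congr 1; rw [← add_assoc]; ring
        _ ≤ _ := abs_add_le _ _
        _ ≤ _ := add_le_add h1 ih
        _ = _ := by rw [← add_assoc]; ring
  have hfar' (j : ℕ) : |a (K + j) - a K| ≤ C * (K : ℝ) ^ (-s - 1) := by
    refine (hfar j).trans ?_
    gcongr
    have : 0 ≤ ((K + j : ℕ) : ℝ) ^ (-s - 1) := by positivity
    linarith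
  have hl : Tendsto (fun j => |a (K + j) - a K|) atTop (𝓝 |z - a K|) := by
    have : Tendsto (fun j => a (K + j)) atTop (𝓝 z) := by
      simp_rw [add_comm K]
      exact (tendsto_add_atTop_iff_nat K).2 halim
    exact (this.sub_const _).abs
  have := le_of_tendsto' hl hfar'
  rw [abs_sub_comm] at this
  refine le_of_eq_of_le (congrArg _ ?_) this
  simp only [ha]
  ring

end ZetaPartialSums

section SquarefullCount

open Finset

/-- The sawtooth function `ψ(t) = {t} - 1/2`. -/
noncomputable def sawtooth (t : ℝ) : ℝ := Int.fract t - 1 / 2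

lemma abs_sawtooth_le (t : ℝ) : |sawtooth t| ≤ 1 := by
  unfold sawtooth
  have h1 := Int.fract_nonneg t
  have h2 := Int.fract_lt_one t
  rw [abs_le]
  constructor <;> linarith

lemma sawtooth_le_add {s t : ℝ} (h : s ≤ t) : sawtooth t ≤ sawtooth s + (t - s) := by
  unfold sawtooth Int.fract
  have : (⌊s⌋ : ℝ) ≤ ⌊t⌋ := by exact_mod_cast Int.floor_mono h
  linarith

lemma fract_add_int_div {θ : ℝ} (h0 : 0 ≤ θ) (h1 : θ < 1) (k : ℤ) {q : ℕ} (hq : 0 < q) :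
    Int.fract ((θ + k) / q) = (θ + (k % q : ℤ)) / q := by
  have hq' : (0 : ℝ) < q := by exact_mod_cast hq
  have hm0 : 0 ≤ k % q := Int.emod_nonneg _ (by positivity)
  have hm1 : k % q < q := Int.emod_lt_of_pos _ (by positivity)
  have hm0' : (0 : ℝ) ≤ (k % q : ℤ) := by exact_mod_cast hm0
  have hm1' : ((k % q : ℤ) : ℝ) ≤ q - 1 := by
    have : (k % q : ℤ) ≤ (q : ℤ) - 1 := by omega
    exact_mod_cast this
  rw [Int.fract_eq_iff]
  refine ⟨by positivity, (div_lt_one hq').2 (by linarith), k / q, ?_⟩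
  have : (k : ℝ) = (k % q : ℤ) + q * (k / q : ℤ) := by
    exact_mod_cast (Int.emod_add_mul_ediv k q).symm
  field_simp
  linarith

lemma sum_emod_of_coprime (m a : ℤ) {q : ℕ} (hq : 0 < q) (h : IsCoprime a (q : ℤ)) :
    ∑ i ∈ range q, ((m + a * i) % q : ℤ) = ∑ i ∈ range q, (i : ℤ) := by
  have hnn (i : ℕ) : 0 ≤ (m + a * i) % (q : ℤ) := Int.emod_nonneg _ (by positivity)
  have hlt (i : ℕ) : (m + a * i) % (q : ℤ) < q := Int.emod_lt_of_pos _ (by positivity)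
  have hmaps : Set.MapsTo (fun i : ℕ => ((m + a * i) % (q : ℤ)).toNat) (range q) (range q) := by
    intro i _
    simp only [coe_range, Set.mem_Iio]
    have := hnn i
    have := hlt i
    omega
  have hinj : Set.InjOn (fun i : ℕ => ((m + a * i) % (q : ℤ)).toNat) (range q) := by
    intro i hi j hj hij
    simp only [coe_range, Set.mem_Iio] at hi hj hij
    have h1 : (m + a * i) % (q : ℤ) = (m + a * j) % (q : ℤ) := by
      have := hnn i
      have := hnn j
      omega
    have h2 : (q : ℤ) ∣ a * (j - i) := by
      have := Int.ModEq.dvd h1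
      convert this using 1
      ring
    have h3 : (q : ℤ) ∣ j - i := h.symm.dvd_of_dvd_mul_left h2
    have h4 := Int.eq_zero_of_abs_lt_dvd h3 (by rw [abs_lt]; constructor <;> omega)
    omega
  refine sum_nbij (fun i : ℕ => ((m + a * i) % (q : ℤ)).toNat) hmaps hinj
    (surjOn_of_injOn_of_card_le _ hmaps hinj le_rfl) ?_
  intro i _
  simp [Int.toNat_of_nonneg (hnn i)]

/-- The sawtooth function has bounded sum over a complete residue system. -/
lemma abs_sum_sawtooth_le (u : ℝ) (a : ℤ) {q : ℕ} (hq : 0 < q) (h : IsCoprime a (q : ℤ)) :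
    |∑ i ∈ range q, sawtooth (u + a * i / q)| ≤ 1 / 2 := by
  have hq' : (0 : ℝ) < q := by exact_mod_cast hq
  set m := ⌊q * u⌋
  set θ := Int.fract (q * u)
  have h0 : 0 ≤ θ := Int.fract_nonneg _
  have h1 : θ < 1 := Int.fract_lt_one _
  have hu : u = (θ + m) / q := by
    have : θ + m = q * u := Int.fract_add_floor _
    rw [this]; field_simp
  have e : ∑ i ∈ range q, sawtooth (u + a * i / q) = θ - 1 / 2 := by
    have e1 (i : ℕ) : sawtooth (u + a * i / q) = (θ + ((m + a * i) % q : ℤ)) / q - 1 / 2 := by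
      rw [sawtooth, ← fract_add_int_div h0 h1 _ hq, hu]
      congr 2
      push_cast
      ring
    simp_rw [e1]
    rw [sum_sub_distrib, ← sum_div, sum_add_distrib]
    have e2 : ∑ i ∈ range q, (((m + a * i) % q : ℤ) : ℝ) = q * (q - 1) / 2 := by
      rw [← Int.cast_sum, sum_emod_of_coprime m a hq h]
      have := Finset.sum_range_id_mul_two q
      have h3 : ((∑ i ∈ range q, (i : ℤ) : ℤ) : ℝ) * 2 = q * (q - 1) := by
        have h4 : (((∑ i ∈ range q, i) * 2 : ℕ) : ℝ) = ((q * (q - 1) : ℕ) : ℝ) := by rw [this]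
        push_cast [Nat.cast_sub hq] at h4 ⊢
        exact h4
      linarith
    rw [e2]
    simp only [sum_const, card_range, nsmul_eq_mul]
    field_simp
    ring
  rw [e, abs_le]
  constructor <;> linarith

/-- Sum of the sawtooth function along a sequence close to an arithmetic progression. -/
lemma abs_sum_sawtooth_le_of_near (g : ℕ → ℝ) (u δ : ℝ) (a : ℤ) {q : ℕ} (hq : 0 < q)
    (h : IsCoprime a (q : ℤ)) (hg : ∀ i < q, |g i - (u + a * i / q)| ≤ δ) :
    |∑ i ∈ range q, sawtooth (g i)| ≤ 1 / 2 + 2 * q * δ := by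
  have hup := abs_le.1 (abs_sum_sawtooth_le (u - δ) a hq h)
  have hlo := abs_le.1 (abs_sum_sawtooth_le (u + δ) a hq h)
  have h1 : ∑ i ∈ range q, sawtooth (g i) ≤
      ∑ i ∈ range q, (sawtooth (u - δ + a * i / q) + 2 * δ) := by
    refine sum_le_sum fun i hi => ?_
    have h2 := abs_le.1 (hg i (mem_range.1 hi))
    have := sawtooth_le_add (s := u - δ + a * i / q) (t := g i) (by linarith)
    linarith
  have h2 : ∑ i ∈ range q, (sawtooth (u + δ + a * i / q) - 2 * δ) ≤
      ∑ i ∈ range q, sawtooth (g i) := by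
    refine sum_le_sum fun i hi => ?_
    have h2 := abs_le.1 (hg i (mem_range.1 hi))
    have := sawtooth_le_add (t := u + δ + a * i / q) (s := g i) (by linarith)
    linarith
  rw [sum_add_distrib] at h1
  rw [sum_sub_distrib] at h2
  simp only [sum_const, card_range, nsmul_eq_mul] at h1 h2
  rw [abs_le]
  constructor <;> linarith

/-- Greedy partition of an interval into blocks of prescribed lengths. -/
lemma exists_spaced_cover (F : ℕ → ℝ) (q : ℕ → ℕ) {M Q : ℕ} {C : ℝ} (hF : ∀ n, |F n| ≤ 1)
    (hq1 : ∀ n, 0 < q n) (hqQ : ∀ n, q n ≤ Q) {m₀ : ℕ}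
    (hC : ∀ n, m₀ ≤ n → n + q n ≤ M → |∑ i ∈ range (q n), F (n + i)| ≤ C) (j m : ℕ) (hm : m₀ ≤ m)
    (hmM : m + j = M) :
    ∃ S ⊆ Ico m M, (∀ s ∈ S, ∀ t ∈ S, s < t → s + q s ≤ t) ∧
      |∑ i ∈ Ico m M, F i| ≤ C * #S + Q := by
  induction j using Nat.strong_induction_on generalizing m with
  | _ j ih =>
    by_cases hb : m + q m ≤ M
    · obtain ⟨S, hS, hsp, hb2⟩ := ih (M - (m + q m)) (by have := hq1 m; omega) (m + q m)
        (by omega) (by omega)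
      have hnot : m ∉ S := fun hmS => by
        have := mem_Ico.1 (hS hmS)
        have := hq1 m
        omega
      refine ⟨insert m S, ?_, ?_, ?_⟩
      · intro s hs
        rcases mem_insert.1 hs with rfl | hs
        · have := hq1 s
          exact mem_Ico.2 ⟨le_rfl, by omega⟩
        · have := mem_Ico.1 (hS hs)
          exact mem_Ico.2 ⟨by omega, by omega⟩
      · intro s hs t ht hst
        rcases mem_insert.1 hs with rfl | hs'
        · rcases mem_insert.1 ht with rfl | ht
          · omega
          · exact (mem_Ico.1 (hS ht)).1
        · rcases mem_insert.1 ht with rfl | ht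
          · have := mem_Ico.1 (hS hs')
            omega
          · exact hsp s hs' t ht hst
      · rw [card_insert_of_notMem hnot, ← sum_Ico_consecutive F (Nat.le_add_right m (q m)) hb]
        have h1 := hC m hm hb
        have h2 : ∑ i ∈ Ico m (m + q m), F i = ∑ i ∈ range (q m), F (m + i) := by
          rw [sum_Ico_eq_sum_range]; simp
        rw [h2]
        refine (abs_add_le _ _).trans ?_
        push_cast
        linarith
    · refine ⟨∅, by simp, by simp, ?_⟩
      have h1 : |∑ i ∈ Ico m M, F i| ≤ ∑ i ∈ Ico m M, (1 : ℝ) :=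
        (abs_sum_le_sum_abs _ _).trans (sum_le_sum fun i _ => hF i)
      simp only [sum_const, Nat.card_Ico, nsmul_eq_mul, mul_one] at h1
      have h2 : ((M - m : ℕ) : ℝ) ≤ Q := by
        have := hqQ m
        exact_mod_cast (by omega : M - m ≤ Q)
      simp only [card_empty, Nat.cast_zero, mul_zero, zero_add]
      linarith

lemma card_le_of_spaced {T : Finset ℕ} {q : ℕ} (hq : 0 < q) {D : ℝ} (hD : 0 ≤ D)
    (hsp : ∀ s ∈ T, ∀ t ∈ T, s < t → s + q ≤ t)
    (hdiam : ∀ s ∈ T, ∀ t ∈ T, s < t → (t : ℝ) - s ≤ D) : (#T : ℝ) ≤ D / q + 1 := by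
  have hq' : (0 : ℝ) < q := by exact_mod_cast hq
  rcases T.eq_empty_or_nonempty with rfl | hne
  · simp; positivity
  set s₀ := T.min' hne
  have hmin (t : ℕ) (ht : t ∈ T) : s₀ ≤ t := T.min'_le t ht
  have hcard : #T ≤ #(range (⌊D / q⌋₊ + 1)) := by
    refine card_le_card_of_injOn (fun s => (s - s₀) / q) ?_ ?_
    · intro t ht
      have ht : t ∈ T := ht
      simp only [coe_range, Set.mem_Iio]
      refine Nat.lt_succ_of_le (Nat.le_floor ?_)
      refine Nat.cast_div_le.trans ?_
      gcongr
      rw [Nat.cast_sub (hmin t ht)]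
      rcases (hmin t ht).eq_or_lt with h | h
      · rw [h]; simpa using hD
      · exact hdiam _ (T.min'_mem hne) t ht h
    · have key : ∀ s ∈ T, ∀ t ∈ T, s < t → (s - s₀) / q < (t - s₀) / q := by
        intro s hs t ht hst
        have h1 := hsp s hs t ht hst
        have h2 := hmin s hs
        calc (s - s₀) / q < (s - s₀ + q) / q := by
              rw [Nat.add_div_right _ hq]; exact Nat.lt_succ_self _
          _ ≤ (t - s₀) / q := Nat.div_le_div_right (by omega)
      intro s hs t ht hst
      rcases lt_trichotomy s t with h | h | h
      · exact absurd hst (key s hs t ht h).ne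
      · exact h
      · exact absurd hst (key t ht s hs h).ne'
  rw [card_range] at hcard
  calc (#T : ℝ) ≤ ((⌊D / q⌋₊ + 1 : ℕ) : ℝ) := by exact_mod_cast hcard
    _ ≤ D / q + 1 := by
      push_cast
      have := Nat.floor_le (by positivity : 0 ≤ D / q)
      linarith

lemma slope_sub_bounds {g : ℕ → ℝ} {m M : ℕ} {l L : ℝ}
    (h : ∀ n, m ≤ n → n < M → l ≤ g (n + 1) - g n ∧ g (n + 1) - g n ≤ L) {s : ℕ} (hs : m ≤ s)
    (i : ℕ) (hi : s + i ≤ M) : l * i ≤ g (s + i) - g s ∧ g (s + i) - g s ≤ L * i := by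
  induction i with
  | zero => simp
  | succ i ih =>
    have h1 := ih (by omega)
    have h2 := h (s + i) (by omega) (by omega)
    rw [← add_assoc]
    push_cast
    constructor <;> linarith [h1.1, h1.2, h2.1, h2.2]

lemma linear_approx_bounds {f : ℕ → ℝ} {m M : ℕ} {l L : ℝ} (hl : 0 ≤ l)
    (h : ∀ n, m ≤ n → n < M →
      l ≤ f (n + 2) - 2 * f (n + 1) + f n ∧ f (n + 2) - 2 * f (n + 1) + f n ≤ L) {s : ℕ}
    (hs : m ≤ s) (i : ℕ) (hi : s + i ≤ M) :
    0 ≤ f (s + i) - f s - i * (f (s + 1) - f s) ∧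
      f (s + i) - f s - i * (f (s + 1) - f s) ≤ L * i ^ 2 / 2 := by
  induction i with
  | zero => simp
  | succ i ih =>
    have h1 := ih (by omega)
    have h2 := slope_sub_bounds (g := fun n => f (n + 1) - f n) (l := l) (L := L)
      (fun n h1 h2 => by
        have := h n h1 h2
        rw [show n + 1 + 1 = n + 2 by ring]
        constructor <;> linarith [this.1, this.2]) hs i (by omega)
    have h3 : 0 ≤ l * i := by positivity
    have hL : 0 ≤ L := by
      have := h s hs (by omega)
      linarith [this.1, this.2]
    rw [← add_assoc]
    push_cast
    constructor
    · linarith [h1.1, h2.1]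
    · nlinarith [h1.2, h2.2]

/-- Sum of the sawtooth function along a sequence with second difference in `[l, L]`. -/
lemma abs_sum_sawtooth_le_of_second_diff {f : ℕ → ℝ} {m M Q : ℕ} {l L : ℝ} (hmM : m ≤ M)
    (hl : 0 < l) (hQ : 0 < Q) (hLQ : L * Q ^ 3 ≤ 1)
    (h : ∀ n, m ≤ n → n < M →
      l ≤ f (n + 2) - 2 * f (n + 1) + f n ∧ f (n + 2) - 2 * f (n + 1) + f n ≤ L) :
    |∑ n ∈ Ico m M, sawtooth (f n)| ≤
      4 * ∑ q ∈ Icc 1 Q, (q * L * ((M : ℝ) - m) + 3) * (2 / (q ^ 2 * Q * l) + 1) + Q := by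
  have hQ' : (0 : ℝ) < Q := by exact_mod_cast hQ
  set g : ℕ → ℝ := fun n => f (n + 1) - f n with hg
  have hgd : ∀ n, m ≤ n → n < M → l ≤ g (n + 1) - g n ∧ g (n + 1) - g n ≤ L := by
    intro n h1 h2
    have := h n h1 h2
    simp only [hg]
    rw [show n + 1 + 1 = n + 2 by ring]
    constructor <;> linarith [this.1, this.2]
  choose r hr hrQ using fun n => Real.exists_rat_abs_sub_le_and_den_le (g n) hQ
  have hden (n : ℕ) : (0 : ℝ) < (r n).den := by exact_mod_cast (r n).den_pos
  have hblock : ∀ n, m ≤ n → n + (r n).den ≤ M →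
      |∑ i ∈ range (r n).den, sawtooth (f (n + i))| ≤ 4 := by
    intro n hmn hnM
    have hnM' : n < M := by have := (r n).den_pos; omega
    have hL : 0 ≤ L := by
      have := h n hmn hnM'
      linarith [this.1, this.2]
    have hqQ : ((r n).den : ℝ) ≤ Q := by exact_mod_cast hrQ n
    have := abs_sum_sawtooth_le_of_near (fun i => f (n + i)) (f n)
      (L * (r n).den ^ 2 / 2 + 1 / (Q + 1)) (r n).num (r n).den_pos
      ((Int.isCoprime_iff_nat_coprime).2 (by simpa using (r n).reduced)) ?_
    · refine this.trans ?_
      have e1 : 2 * ((r n).den : ℝ) * (L * (r n).den ^ 2 / 2 + 1 / (Q + 1)) =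
          L * (r n).den ^ 3 + 2 * ((r n).den / (Q + 1)) := by ring
      have e2 : L * ((r n).den : ℝ) ^ 3 ≤ 1 := by
        refine le_trans ?_ hLQ
        gcongr
      have e3 : ((r n).den : ℝ) / (Q + 1) ≤ 1 := by
        rw [div_le_one (by positivity)]; linarith
      rw [e1]
      linarith
    · intro i hi
      have h1 := linear_approx_bounds hl.le h hmn i (by omega)
      have hi' : (i : ℝ) ≤ (r n).den := by exact_mod_cast hi.le
      have h2 : (i : ℝ) * |g n - r n| ≤ 1 / (Q + 1) := by
        calc (i : ℝ) * |g n - r n| ≤ (r n).den * (1 / ((Q + 1) * (r n).den)) := by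
              gcongr
              exact hr n
          _ = 1 / (Q + 1) := by have := hden n; field_simp
      have h3 : L * (i : ℝ) ^ 2 ≤ L * (r n).den ^ 2 := by gcongr
      have h4 : ((r n).num : ℝ) * i / (r n).den = r n * i := by
        rw [mul_div_right_comm]
        congr 1
        exact_mod_cast (r n).num_div_den
      rw [h4]
      have e : f (n + i) - (f n + r n * i) =
          (f (n + i) - f n - i * (f (n + 1) - f n)) + i * (g n - r n) := by simp only [hg]; ring
      rw [e]
      refine (abs_add_le _ _).trans (add_le_add ?_ ?_)
      · rw [abs_of_nonneg h1.1]
        linarith [h1.2]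
      · rwa [abs_mul, Nat.abs_cast]
  obtain ⟨S, hS, hsp, hb⟩ := exists_spaced_cover (fun n => sawtooth (f n)) (fun n => (r n).den)
    (M := M) (Q := Q) (C := 4) (m₀ := m) (fun n => abs_sawtooth_le _) (fun n => (r n).den_pos) hrQ
    hblock (M - m) m le_rfl (by omega)
  refine hb.trans ?_
  gcongr
  have hcard : #S = ∑ q ∈ Icc 1 Q, #{s ∈ S | (r s).den = q} :=
    card_eq_sum_card_fiberwise (fun s _ => mem_Icc.2 ⟨(r s).den_pos, hrQ s⟩)
  rw [hcard]
  push_cast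
  refine sum_le_sum fun q hq => ?_
  have hq1 : 0 < q := (mem_Icc.1 hq).1
  have hq' : (0 : ℝ) < q := by exact_mod_cast hq1
  set T := {s ∈ S | (r s).den = q} with hT
  have hTm {s : ℕ} (hs : s ∈ T) : s ∈ S ∧ (r s).den = q ∧ m ≤ s ∧ s < M := by
    have h1 := mem_filter.1 hs
    have h2 := mem_Ico.1 (hS h1.1)
    exact ⟨h1.1, h1.2, h2.1, h2.2⟩
  have hnear {s : ℕ} (hs : s ∈ T) : |g s * q - (r s).num| ≤ 1 / (Q + 1) := by
    have h1 := hr s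
    have h2 := hTm hs
    rw [h2.2.1] at h1
    have h3 : (r s : ℝ) * q = (r s).num := by
      have := Rat.mul_den_eq_num (r s)
      rw [h2.2.1] at this
      exact_mod_cast this
    rw [← h3, ← sub_mul, abs_mul, Nat.abs_cast]
    calc |g s - r s| * q ≤ 1 / ((Q + 1) * q) * q := by gcongr
      _ = 1 / (Q + 1) := by field_simp
  have hQ1 : 1 / ((Q : ℝ) + 1) ≤ 1 := by
    rw [div_le_one (by positivity)]; linarith
  rcases T.eq_empty_or_nonempty with hTe | hTne
  · rw [hTe]
    simp only [card_empty, Nat.cast_zero]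
    have : 0 ≤ L * ((M : ℝ) - m) := by
      rcases hmM.eq_or_lt with h1 | h1
      · simp [h1]
      · have h2 := h m le_rfl h1
        have : (0 : ℝ) ≤ M - m := by
          have : (m : ℝ) ≤ M := by exact_mod_cast hmM
          linarith
        have : 0 ≤ L := by linarith [h2.1, h2.2]
        positivity
    rw [mul_assoc]
    positivity
  have hlt : m < M := by
    obtain ⟨s, hs⟩ := hTne
    have := hTm hs
    omega
  have hL : 0 ≤ L := by
    have h2 := h m le_rfl hlt
    linarith [h2.1, h2.2]
  have hmM' : (m : ℝ) ≤ M := by exact_mod_cast hmM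
  -- each fibre over a fixed fraction is short
  have hfib : ∀ a ∈ T.image (fun s => (r s).num),
      #{s ∈ T | (r s).num = a} ≤ ⌊2 / ((q : ℝ) ^ 2 * Q * l) + 1⌋₊ := by
    intro a _
    refine Nat.le_floor ?_
    have hD := card_le_of_spaced (T := {s ∈ T | (r s).num = a}) hq1 (D := 2 / (q * Q * l))
      (by positivity) ?_ ?_
    · refine hD.trans (le_of_eq ?_)
      field_simp
    · intro s hs t ht hst
      have h1 := hTm (mem_filter.1 hs).1
      have h2 := hTm (mem_filter.1 ht).1
      have := hsp s h1.1 t h2.1 hst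
      rwa [h1.2.1] at this
    · intro s hs t ht hst
      have h1 := hTm (mem_filter.1 hs).1
      have h2 := hTm (mem_filter.1 ht).1
      have h3 := abs_le.1 (hnear (mem_filter.1 hs).1)
      have h4 := abs_le.1 (hnear (mem_filter.1 ht).1)
      rw [(mem_filter.1 hs).2] at h3
      rw [(mem_filter.1 ht).2] at h4
      have h5 := (slope_sub_bounds hgd h1.2.2.1 (t - s) (by omega)).1
      rw [Nat.add_sub_cancel' hst.le, Nat.cast_sub hst.le] at h5
      have h6 : (g t - g s) * q ≤ 2 / (Q + 1) := by
        have : (2 : ℝ) / (Q + 1) = 1 / (Q + 1) + 1 / (Q + 1) := by ring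
        rw [this]
        linarith [h3.1, h4.2]
      have h7 : (2 : ℝ) / (Q + 1) ≤ 2 / Q := by
        gcongr
        linarith
      have h8 : l * ((t : ℝ) - s) * q ≤ 2 / Q :=
        (mul_le_mul_of_nonneg_right h5 hq'.le).trans (h6.trans h7)
      rw [le_div_iff₀ hQ'] at h8
      rw [le_div_iff₀ (by positivity)]
      linarith
  have himg : (#(T.image (fun s => (r s).num)) : ℝ) ≤ q * L * ((M : ℝ) - m) + 3 := by
    have hsub : T.image (fun s => (r s).num) ⊆ Icc ⌈g m * q - 1⌉ ⌊g m * q + L * (M - m) * q + 1⌋ := by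
      intro a ha
      obtain ⟨s, hs, rfl⟩ := mem_image.1 ha
      have h1 := hTm hs
      have h2 := abs_le.1 (hnear hs)
      have h3 := slope_sub_bounds hgd le_rfl (s - m) (by omega)
      rw [Nat.add_sub_cancel' h1.2.2.1, Nat.cast_sub h1.2.2.1] at h3
      have h4 : (m : ℝ) ≤ s := by exact_mod_cast h1.2.2.1
      have h5 : (s : ℝ) ≤ M := by exact_mod_cast h1.2.2.2.le
      have h6 : 0 ≤ g s - g m := le_trans (mul_nonneg hl.le (by linarith)) h3.1
      have h7 : g s - g m ≤ L * (M - m) := h3.2.trans (by gcongr)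
      refine mem_Icc.2 ⟨Int.ceil_le.2 ?_, Int.le_floor.2 ?_⟩
      · have := mul_nonneg h6 hq'.le
        linarith [h2.2]
      · have := mul_le_mul_of_nonneg_right h7 hq'.le
        linarith [h2.1]
    have h1 : (#(T.image (fun s => (r s).num)) : ℝ) ≤
        #(Icc ⌈g m * q - 1⌉ ⌊g m * q + L * (M - m) * q + 1⌋) := by
      exact_mod_cast card_le_card hsub
    refine h1.trans ?_
    rw [Int.card_Icc]
    have h2 : (⌊g m * q + L * (M - m) * q + 1⌋ : ℝ) ≤ _ := Int.floor_le _
    have h3 : g m * q - 1 ≤ (⌈g m * q - 1⌉ : ℝ) := Int.le_ceil _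
    have h4 : (0 : ℝ) ≤ q * L * ((M : ℝ) - m) + 3 := by
      have : (0 : ℝ) ≤ (M : ℝ) - m := by linarith
      positivity
    have h5 : (((⌊g m * q + L * (M - m) * q + 1⌋ + 1 - ⌈g m * q - 1⌉).toNat : ℤ) : ℝ) ≤
        q * L * ((M : ℝ) - m) + 3 := by
      rw [Int.toNat_eq_max]
      push_cast
      refine max_le ?_ h4
      linarith
    exact_mod_cast h5
  have hmain := card_le_mul_card_image (f := fun s => (r s).num) T _ hfib
  calc (#T : ℝ) ≤ (⌊2 / ((q : ℝ) ^ 2 * Q * l) + 1⌋₊ : ℝ) * #(T.image (fun s => (r s).num)) := by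
        exact_mod_cast hmain
    _ ≤ (2 / ((q : ℝ) ^ 2 * Q * l) + 1) * (q * L * ((M : ℝ) - m) + 3) := by
        gcongr
        exact Nat.floor_le (by positivity)
    _ = _ := mul_comm _ _

lemma sum_inv_le_rpow {Q : ℕ} (hQ : 0 < Q) :
    ∑ q ∈ Icc 1 Q, (1 / q : ℝ) ≤ 11 * (Q : ℝ) ^ (1 / 10 : ℝ) := by
  have h1 : ∑ q ∈ Icc 1 Q, (1 / q : ℝ) = (harmonic Q : ℝ) := by
    rw [harmonic_eq_sum_Icc]; push_cast; simp
  have h2 := harmonic_le_one_add_log Q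
  have h3 := Real.log_le_rpow_div (Nat.cast_nonneg Q) (by norm_num : (0 : ℝ) < 1 / 10)
  have h4 : (1 : ℝ) ≤ (Q : ℝ) ^ (1 / 10 : ℝ) :=
    Real.one_le_rpow (by exact_mod_cast hQ) (by norm_num)
  rw [h1]
  linarith

lemma abs_sum_sawtooth_le_of_comparable {f : ℕ → ℝ} {m M Q : ℕ} {L c : ℝ} (hmM : m ≤ M)
    (hL : 0 < L) (hc : 1 ≤ c) (hQ : 0 < Q) (hLQ : L * Q ^ 3 ≤ 1) (hLQ' : 1 ≤ 8 * (L * Q ^ 3))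
    (h : ∀ n, m ≤ n → n < M →
      L / c ≤ f (n + 2) - 2 * f (n + 1) + f n ∧ f (n + 2) - 2 * f (n + 1) + f n ≤ L) :
    |∑ n ∈ Ico m M, sawtooth (f n)| ≤
      2300 * c * ((Q : ℝ) ^ (1 / 10 : ℝ) * (((M : ℝ) - m) / Q + Q ^ 2)) := by
  have hc0 : 0 < c := by linarith
  have hQ1 : (1 : ℝ) ≤ Q := by exact_mod_cast hQ
  have hQ0 : (0 : ℝ) < Q := by linarith
  have hN : 0 ≤ (M : ℝ) - m := by
    have : (m : ℝ) ≤ M := by exact_mod_cast hmM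
    linarith
  set N := (M : ℝ) - m
  refine (abs_sum_sawtooth_le_of_second_diff hmM (by positivity) hQ hLQ h).trans ?_
  have hterm : ∀ q ∈ Icc 1 Q, ((q : ℝ) * L * N + 3) * (2 / (q ^ 2 * Q * (L / c)) + 1) ≤
      (c * (3 * (N / Q) + 51 * Q ^ 2)) * (1 / q) := by
    intro q hq
    have hq1 : (1 : ℝ) ≤ q := by exact_mod_cast (mem_Icc.1 hq).1
    have hqQ : (q : ℝ) ≤ Q := by exact_mod_cast (mem_Icc.1 hq).2
    have hq0 : (0 : ℝ) < q := by linarith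
    have e : ((q : ℝ) * L * N + 3) * (2 / (q ^ 2 * Q * (L / c)) + 1) =
        (2 * c * (N / Q) + q ^ 2 * L * N + 6 * c / (q * (Q * L)) + 3 * q) * (1 / q) := by
      field_simp
      ring
    rw [e]
    gcongr
    have h1 : q ^ 2 * L * N ≤ c * (N / Q) := by
      calc q ^ 2 * L * N ≤ Q ^ 2 * L * N := by gcongr
        _ = (L * Q ^ 3) * (N / Q) := by field_simp
        _ ≤ 1 * (N / Q) := by gcongr
        _ ≤ c * (N / Q) := by gcongr
    have h2 : 6 * c / (q * (Q * L)) ≤ 48 * c * Q ^ 2 := by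
      rw [div_le_iff₀ (by positivity)]
      calc 6 * c ≤ 6 * c * (8 * (L * Q ^ 3)) := by
            exact le_mul_of_one_le_right (by positivity) hLQ'
        _ = 48 * c * Q ^ 2 * (1 * (Q * L)) := by ring
        _ ≤ 48 * c * Q ^ 2 * (q * (Q * L)) := by gcongr
    have h3 : 3 * (q : ℝ) ≤ c * (3 * Q ^ 2) := by
      have : (q : ℝ) ≤ Q ^ 2 := by nlinarith
      nlinarith [sq_nonneg (Q : ℝ)]
    linarith
  have hsum := sum_le_sum hterm
  rw [← mul_sum] at hsum
  have hpos : 0 ≤ c * (3 * (N / Q) + 51 * (Q : ℝ) ^ 2) := by positivity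
  have h5 := mul_le_mul_of_nonneg_left (sum_inv_le_rpow hQ) hpos
  have h4 : (1 : ℝ) ≤ (Q : ℝ) ^ (1 / 10 : ℝ) := Real.one_le_rpow hQ1 (by norm_num)
  have h6 : (Q : ℝ) ≤ c * ((Q : ℝ) ^ (1 / 10 : ℝ) * Q ^ 2) := by
    calc (Q : ℝ) ≤ 1 * (1 * Q ^ 2) := by nlinarith
      _ ≤ _ := by gcongr
  have h7 : 0 ≤ c * ((Q : ℝ) ^ (1 / 10 : ℝ) * (N / Q)) := by positivity
  nlinarith [hsum, h5, h6, h7]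

lemma abs_sum_sawtooth_le_trivial (f : ℕ → ℝ) {m M : ℕ} (hmM : m ≤ M) :
    |∑ n ∈ Ico m M, sawtooth (f n)| ≤ (M : ℝ) - m := by
  refine (abs_sum_le_sum_abs _ _).trans ((sum_le_sum fun i _ => abs_sawtooth_le _).trans ?_)
  simp [Nat.cast_sub hmM]

lemma abs_sum_sawtooth_le_rpow {f : ℕ → ℝ} {m M : ℕ} {L c : ℝ} (hmM : m ≤ M)
    (hL : 0 < L) (hc : 1 ≤ c)
    (h : ∀ n, m ≤ n → n < M →
      L / c ≤ f (n + 2) - 2 * f (n + 1) + f n ∧ f (n + 2) - 2 * f (n + 1) + f n ≤ L) :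
    |∑ n ∈ Ico m M, sawtooth (f n)| ≤
      4600 * c * (((M : ℝ) - m) * L ^ (3 / 10 : ℝ) + L ^ (-7 / 10 : ℝ)) := by
  have hN : 0 ≤ (M : ℝ) - m := by
    have : (m : ℝ) ≤ M := by exact_mod_cast hmM
    linarith
  rcases le_total L 1 with hL1 | hL1
  · set y := L ^ (-1 / 3 : ℝ) with hy
    have hy1 : 1 ≤ y := Real.one_le_rpow_of_pos_of_le_one_of_nonpos hL hL1 (by norm_num)
    have hy0 : 0 < y := by linarith
    have hyL : L * y ^ 3 = 1 := by
      rw [hy, ← Real.rpow_natCast, ← Real.rpow_mul hL.le]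
      norm_num
      rw [Real.rpow_neg_one]
      field_simp
    set Q := ⌊y⌋₊ with hQdef
    have hQ : 0 < Q := Nat.floor_pos.2 hy1
    have hQ1 : (1 : ℝ) ≤ Q := by exact_mod_cast hQ
    have hQy : (Q : ℝ) ≤ y := Nat.floor_le hy0.le
    have hyQ : y ≤ 2 * Q := by
      have := Nat.lt_floor_add_one y
      linarith
    refine (abs_sum_sawtooth_le_of_comparable hmM hL hc hQ ?_ ?_ h).trans ?_
    · rw [← hyL]; gcongr
    · rw [← hyL]
      calc L * y ^ 3 ≤ L * (2 * Q) ^ 3 := by gcongr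
        _ = _ := by ring
    have hQ0 : (0 : ℝ) < Q := by linarith
    have h1 : (Q : ℝ) ^ (1 / 10 : ℝ) * (((M : ℝ) - m) / Q) ≤
        2 * (((M : ℝ) - m) * L ^ (3 / 10 : ℝ)) := by
      have e : (Q : ℝ) ^ (1 / 10 : ℝ) * (((M : ℝ) - m) / Q) =
          ((M : ℝ) - m) * (Q : ℝ) ^ (-9 / 10 : ℝ) := by
        rw [show (-9 / 10 : ℝ) = 1 / 10 - 1 by norm_num, Real.rpow_sub_one hQ0.ne']
        ring
      have h2 : (Q : ℝ) ^ (-9 / 10 : ℝ) ≤ 2 * L ^ (3 / 10 : ℝ) := by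
        calc (Q : ℝ) ^ (-9 / 10 : ℝ) ≤ (y / 2) ^ (-9 / 10 : ℝ) :=
              Real.rpow_le_rpow_of_nonpos (by positivity) (by linarith) (by norm_num)
          _ = (2 : ℝ) ^ (9 / 10 : ℝ) * L ^ (3 / 10 : ℝ) := by
              rw [Real.div_rpow hy0.le (by norm_num), hy, ← Real.rpow_mul hL.le, div_eq_mul_inv,
                ← Real.rpow_neg (by norm_num), mul_comm]
              norm_num
          _ ≤ 2 * L ^ (3 / 10 : ℝ) := by
              gcongr
              calc (2 : ℝ) ^ (9 / 10 : ℝ) ≤ 2 ^ (1 : ℝ) :=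
                    Real.rpow_le_rpow_of_exponent_le (by norm_num) (by norm_num)
                _ = 2 := by norm_num
      rw [e]
      calc ((M : ℝ) - m) * (Q : ℝ) ^ (-9 / 10 : ℝ) ≤ ((M : ℝ) - m) * (2 * L ^ (3 / 10 : ℝ)) := by
            gcongr
        _ = _ := by ring
    have h2 : (Q : ℝ) ^ (1 / 10 : ℝ) * (Q : ℝ) ^ 2 ≤ L ^ (-7 / 10 : ℝ) := by
      calc (Q : ℝ) ^ (1 / 10 : ℝ) * (Q : ℝ) ^ 2 = (Q : ℝ) ^ (21 / 10 : ℝ) := by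
            rw [← Real.rpow_natCast, ← Real.rpow_add hQ0]; norm_num
        _ ≤ y ^ (21 / 10 : ℝ) := by gcongr
        _ = _ := by
            rw [hy, ← Real.rpow_mul hL.le]; norm_num
    have h3 : 0 ≤ L ^ (-7 / 10 : ℝ) := by positivity
    calc 2300 * c * ((Q : ℝ) ^ (1 / 10 : ℝ) * (((M : ℝ) - m) / Q + Q ^ 2))
        ≤ 2300 * c * (2 * (((M : ℝ) - m) * L ^ (3 / 10 : ℝ)) + 2 * L ^ (-7 / 10 : ℝ)) := by
          refine mul_le_mul_of_nonneg_left ?_ (by positivity)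
          rw [mul_add]
          linarith
      _ = _ := by ring
  · refine (abs_sum_sawtooth_le_trivial f hmM).trans ?_
    have h1 : 1 ≤ L ^ (3 / 10 : ℝ) := Real.one_le_rpow hL1 (by norm_num)
    have h2 : 0 ≤ L ^ (-7 / 10 : ℝ) := by positivity
    calc (M : ℝ) - m ≤ 1 * (((M : ℝ) - m) * 1 + 0) := by linarith
      _ ≤ _ := by
        gcongr
        linarith

lemma exists_second_diff_eq {φ φ' φ'' : ℝ → ℝ} {t : ℝ}
    (h1 : ∀ y ∈ Set.Icc t (t + 2), HasDerivAt φ (φ' y) y)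
    (h2 : ∀ y ∈ Set.Icc t (t + 2), HasDerivAt φ' (φ'' y) y) :
    ∃ ξ ∈ Set.Icc t (t + 2), φ (t + 2) - 2 * φ (t + 1) + φ t = φ'' ξ := by
  have hu : ∀ y ∈ Set.Icc t (t + 1),
      HasDerivAt (fun y => φ (y + 1) - φ y) (φ' (y + 1) - φ' y) y := by
    intro y hy
    refine HasDerivAt.sub ?_ (h1 y ⟨hy.1, by linarith [hy.2]⟩)
    exact (h1 (y + 1) ⟨by linarith [hy.1], by linarith [hy.2]⟩).comp_add_const y 1
  obtain ⟨y, hy, hy'⟩ := exists_hasDerivAt_eq_slope (fun y => φ (y + 1) - φ y)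
    (fun y => φ' (y + 1) - φ' y) (by linarith : t < t + 1)
    (fun y hy => (hu y hy).continuousAt.continuousWithinAt) (fun y hy => hu y ⟨hy.1.le, hy.2.le⟩)
  obtain ⟨ξ, hξ, hξ'⟩ := exists_hasDerivAt_eq_slope φ' φ'' (by linarith : y < y + 1)
    (fun z hz => (h2 z ⟨by linarith [hy.1, hz.1], by linarith [hy.2, hz.2]⟩).continuousAt
      |>.continuousWithinAt) (fun z hz => h2 z ⟨by linarith [hy.1, hz.1], by linarith [hy.2, hz.2]⟩)
  refine ⟨ξ, ⟨by linarith [hy.1, hξ.1], by linarith [hy.2, hξ.2]⟩, ?_⟩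
  rw [hξ', add_sub_cancel_left, div_one, hy', add_sub_cancel_left, div_one,
    show t + 1 + 1 = t + 2 by ring]
  ring

lemma second_diff_rpow_bounds {X s : ℝ} (hX : 0 < X) (hs : 0 < s) {N n : ℕ} (hN : 0 < N)
    (h1 : N ≤ n) (h2 : n < 2 * N) {L : ℝ} (hL : L = s * (s + 1) * X * (N : ℝ) ^ (-s - 2)) :
    L / 4 ^ (s + 2) ≤ X * ((n + 2 : ℕ) : ℝ) ^ (-s) - 2 * (X * ((n + 1 : ℕ) : ℝ) ^ (-s))
      + X * (n : ℝ) ^ (-s) ∧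
    X * ((n + 2 : ℕ) : ℝ) ^ (-s) - 2 * (X * ((n + 1 : ℕ) : ℝ) ^ (-s)) + X * (n : ℝ) ^ (-s) ≤ L := by
  have hN' : (0 : ℝ) < N := by exact_mod_cast hN
  have hn : (N : ℝ) ≤ n := by exact_mod_cast h1
  have hd1 : ∀ y ∈ Set.Icc (n : ℝ) (n + 2),
      HasDerivAt (fun y : ℝ => X * y ^ (-s)) (X * (-s * y ^ (-s - 1))) y := by
    intro y hy
    have : 0 < y := by linarith [hy.1]
    exact (Real.hasDerivAt_rpow_const (Or.inl this.ne')).const_mul X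
  have hd2 : ∀ y ∈ Set.Icc (n : ℝ) (n + 2),
      HasDerivAt (fun y : ℝ => X * (-s * y ^ (-s - 1))) (X * (s * (s + 1) * y ^ (-s - 2))) y := by
    intro y hy
    have : 0 < y := by linarith [hy.1]
    refine (((Real.hasDerivAt_rpow_const (p := -s - 1) (Or.inl this.ne')).const_mul
      (-s)).const_mul X).congr_deriv ?_
    rw [show -s - 1 - 1 = -s - 2 by ring]
    ring
  obtain ⟨ξ, hξ, e⟩ := exists_second_diff_eq hd1 hd2
  push_cast
  rw [e]
  have hξ0 : 0 < ξ := by linarith [hξ.1]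
  have h4 : (n : ℝ) + 2 ≤ 4 * N := by exact_mod_cast (by omega : n + 2 ≤ 4 * N)
  have h3 : ξ ≤ 4 * N := hξ.2.trans h4
  have e4 : ((4 * N : ℝ)) ^ (-s - 2) = (N : ℝ) ^ (-s - 2) / 4 ^ (s + 2) := by
    rw [Real.mul_rpow (by norm_num) hN'.le, show -s - 2 = -(s + 2) by ring,
      Real.rpow_neg (by norm_num)]
    field_simp
  have b1 : (4 * N : ℝ) ^ (-s - 2) ≤ ξ ^ (-s - 2) :=
    Real.rpow_le_rpow_of_nonpos hξ0 h3 (by linarith)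
  have b2 : ξ ^ (-s - 2) ≤ (N : ℝ) ^ (-s - 2) :=
    Real.rpow_le_rpow_of_nonpos hN' (hn.trans hξ.1) (by linarith)
  constructor
  · calc L / 4 ^ (s + 2) = X * (s * (s + 1) * (4 * N : ℝ) ^ (-s - 2)) := by rw [e4, hL]; ring
      _ ≤ _ := by gcongr
  · calc X * (s * (s + 1) * ξ ^ (-s - 2)) ≤ X * (s * (s + 1) * (N : ℝ) ^ (-s - 2)) := by gcongr
      _ = L := by rw [hL]; ring

lemma abs_sum_le_of_dyadic {F : ℕ → ℝ} {E : ℝ} {K : ℕ}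
    (h : ∀ N M, 0 < N → N ≤ M → M ≤ 2 * N → N ≤ K → |∑ n ∈ Ico N M, F n| ≤ E) (j M : ℕ)
    (hM : M ≤ K + 1) (hj : M ≤ 2 ^ j) (hE : 0 ≤ E) : |∑ n ∈ Ico 1 M, F n| ≤ j * E := by
  induction j generalizing M with
  | zero => rw [Ico_eq_empty_of_le (by simpa using hj)]; simp
  | succ j ih =>
    rcases le_or_gt M (2 ^ j) with h1 | h1
    · refine (ih M hM h1).trans ?_
      gcongr
      simp
    · have hp : 0 < 2 ^ j := by positivity
      rw [← sum_Ico_consecutive F (by omega : 1 ≤ 2 ^ j) h1.le]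
      have h2 := ih (2 ^ j) (by omega) le_rfl
      have h3 := h (2 ^ j) M hp h1.le (by rw [pow_succ] at hj; omega) (by omega)
      refine (abs_add_le _ _).trans ?_
      push_cast
      linarith

lemma rpow_le_rpow_of_pow_five_le {N x r w : ℝ} (hN : 1 ≤ N) (hx : N ^ 5 ≤ x) (hw : 0 ≤ w)
    (hr : r ≤ 5 * w) : N ^ r ≤ x ^ w := by
  have hN0 : 0 < N := by linarith
  calc N ^ r ≤ N ^ (5 * w) := Real.rpow_le_rpow_of_exponent_le hN hr
    _ = (N ^ 5) ^ w := by rw [Real.rpow_mul hN0.le]; norm_cast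
    _ ≤ x ^ w := by gcongr

/-- Bound for sums of the sawtooth function along `x ^ e * n ^ (-s)`. -/
lemma exists_sum_sawtooth_bound {e s : ℝ} (he0 : 0 < e) (hs : 0 < s) (he : e ≤ 1 / 2)
    (h1 : 1 - 3 / 10 * (s + 2) ≤ 3 / 4 - 3 / 2 * e) (h2 : 7 / 10 * (s + 2) ≤ 3 / 4 + 7 / 2 * e) :
    ∃ C : ℝ, 0 < C ∧ ∀ (x : ℝ) (K : ℕ), 0 < K → (K : ℝ) ^ 5 ≤ x →
      |∑ n ∈ Icc 1 K, sawtooth (x ^ e * (n : ℝ) ^ (-s))| ≤ C * x ^ (1 / 6 : ℝ) := by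
  set κ := s * (s + 1) with hκ
  have hκ0 : 0 < κ := by positivity
  set c : ℝ := 4 ^ (s + 2) with hcdef
  have hc : 1 ≤ c := Real.one_le_rpow (by norm_num) (by linarith)
  set B := 4600 * c * (κ ^ (3 / 10 : ℝ) + κ ^ (-7 / 10 : ℝ)) with hB
  have hB0 : 0 < B := by positivity
  refine ⟨121 * B, by positivity, fun x K hK hKx => ?_⟩
  have hK1 : (1 : ℝ) ≤ K := by exact_mod_cast hK
  have hx1 : 1 ≤ x := (one_le_pow₀ hK1).trans hKx
  have hx0 : 0 < x := by linarith
  have hdy : ∀ N M, 0 < N → N ≤ M → M ≤ 2 * N → N ≤ K →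
      |∑ n ∈ Ico N M, sawtooth (x ^ e * (n : ℝ) ^ (-s))| ≤ B * x ^ (3 / 20 : ℝ) := by
    intro N M hN hNM hM hNK
    have hN1 : (1 : ℝ) ≤ N := by exact_mod_cast hN
    have hN0 : (0 : ℝ) < N := by linarith
    have hNx : (N : ℝ) ^ 5 ≤ x := by
      refine le_trans ?_ hKx
      gcongr
    set L := s * (s + 1) * x ^ e * (N : ℝ) ^ (-s - 2) with hL
    have hL0 : 0 < L := by positivity
    refine (abs_sum_sawtooth_le_rpow hNM hL0 hc (fun n hn1 hn2 =>
      second_diff_rpow_bounds (by positivity) hs hN hn1 (by omega) hL)).trans ?_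
    have hMN : (M : ℝ) - N ≤ N := by
      have : (M : ℝ) ≤ 2 * N := by exact_mod_cast hM
      linarith
    have eL (r : ℝ) : L ^ r = κ ^ r * (x ^ (e * r) * (N : ℝ) ^ ((-s - 2) * r)) := by
      rw [hL, Real.mul_rpow (by positivity) (by positivity), Real.mul_rpow (by positivity)
        (by positivity), ← Real.rpow_mul hx0.le, ← Real.rpow_mul hN0.le]
      ring
    have b1 : (N : ℝ) * L ^ (3 / 10 : ℝ) ≤ κ ^ (3 / 10 : ℝ) * x ^ (3 / 20 : ℝ) := by
      have e1 : (N : ℝ) * L ^ (3 / 10 : ℝ) = κ ^ (3 / 10 : ℝ) * (x ^ (e * (3 / 10))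
          * (N : ℝ) ^ (1 + (-s - 2) * (3 / 10))) := by
        rw [eL, Real.rpow_add hN0, Real.rpow_one]; ring
      rw [e1]
      gcongr
      calc x ^ (e * (3 / 10)) * (N : ℝ) ^ (1 + (-s - 2) * (3 / 10))
          ≤ x ^ (e * (3 / 10)) * x ^ (3 / 20 - e * (3 / 10)) := by
            gcongr
            exact rpow_le_rpow_of_pow_five_le hN1 hNx (by linarith) (by linarith)
        _ = x ^ (3 / 20 : ℝ) := by rw [← Real.rpow_add hx0, add_sub_cancel]
    have b2 : L ^ (-7 / 10 : ℝ) ≤ κ ^ (-7 / 10 : ℝ) * x ^ (3 / 20 : ℝ) := by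
      rw [eL]
      gcongr
      calc x ^ (e * (-7 / 10)) * (N : ℝ) ^ ((-s - 2) * (-7 / 10))
          ≤ x ^ (e * (-7 / 10)) * x ^ (3 / 20 - e * (-7 / 10)) := by
            gcongr
            exact rpow_le_rpow_of_pow_five_le hN1 hNx (by linarith) (by linarith)
        _ = x ^ (3 / 20 : ℝ) := by rw [← Real.rpow_add hx0, add_sub_cancel]
    calc 4600 * c * (((M : ℝ) - N) * L ^ (3 / 10 : ℝ) + L ^ (-7 / 10 : ℝ))
        ≤ 4600 * c * (N * L ^ (3 / 10 : ℝ) + L ^ (-7 / 10 : ℝ)) := by gcongr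
      _ ≤ 4600 * c * (κ ^ (3 / 10 : ℝ) * x ^ (3 / 20 : ℝ) + κ ^ (-7 / 10 : ℝ) * x ^ (3 / 20 : ℝ)) := by
          gcongr
      _ = B * x ^ (3 / 20 : ℝ) := by rw [hB]; ring
  have hlt : K + 1 ≤ 2 ^ (Nat.log 2 K + 1) := Nat.lt_pow_succ_log_self (by norm_num) K
  have hmain := abs_sum_le_of_dyadic hdy (Nat.log 2 K + 1) (K + 1) le_rfl hlt (by positivity)
  have hIcc : Ico 1 (K + 1) = Icc 1 K := by ext; simp
  rw [hIcc] at hmain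
  refine hmain.trans ?_
  have hj : ((Nat.log 2 K + 1 : ℕ) : ℝ) ≤ 121 * x ^ (1 / 60 : ℝ) := by
    have g1 := Real.natLog_le_logb K 2
    have g2 : Real.logb (2 : ℕ) K ≤ 2 * Real.log K := by
      rw [Real.logb, div_le_iff₀ (Real.log_pos (by norm_num))]
      have : (1 / 2 : ℝ) ≤ Real.log (2 : ℕ) := by
        have := Real.log_two_gt_d9
        push_cast
        linarith
      calc Real.log K = 2 * Real.log K * (1 / 2) := by ring
        _ ≤ 2 * Real.log K * Real.log (2 : ℕ) := by
          have := Real.log_nonneg hK1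
          gcongr
    have g3 : Real.log K ≤ Real.log x :=
      Real.log_le_log (by linarith) ((le_self_pow₀ hK1 (by norm_num)).trans hKx)
    have g4 := Real.log_le_rpow_div hx0.le (by norm_num : (0 : ℝ) < 1 / 60)
    have g5 : 1 ≤ x ^ (1 / 60 : ℝ) := Real.one_le_rpow hx1 (by norm_num)
    push_cast
    linarith
  calc ((Nat.log 2 K + 1 : ℕ) : ℝ) * (B * x ^ (3 / 20 : ℝ))
      ≤ 121 * x ^ (1 / 60 : ℝ) * (B * x ^ (3 / 20 : ℝ)) := by gcongr
    _ = 121 * B * (x ^ (1 / 60 : ℝ) * x ^ (3 / 20 : ℝ)) := by ring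
    _ = 121 * B * x ^ (1 / 6 : ℝ) := by rw [← Real.rpow_add hx0]; norm_num

/-- The pairs `(a, b)` of positive integers with `a ^ 2 * b ^ 3 ≤ N`. -/
def sqCubePairs (N : ℕ) : Finset (ℕ × ℕ) :=
  (Icc 1 N ×ˢ Icc 1 N).filter fun c => c.1 ^ 2 * c.2 ^ 3 ≤ N

lemma mem_sqCubePairs {N : ℕ} {c : ℕ × ℕ} :
    c ∈ sqCubePairs N ↔ 0 < c.1 ∧ 0 < c.2 ∧ c.1 ^ 2 * c.2 ^ 3 ≤ N := by
  simp only [sqCubePairs, mem_filter, mem_product, mem_Icc]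
  refine ⟨fun h => ⟨h.1.1.1, h.1.2.1, h.2⟩, fun ⟨h1, h2, h3⟩ => ⟨⟨⟨h1, ?_⟩, h2, ?_⟩, h3⟩⟩
  · calc c.1 ≤ c.1 ^ 2 := Nat.le_self_pow (by norm_num) _
      _ ≤ c.1 ^ 2 * c.2 ^ 3 := Nat.le_mul_of_pos_right _ (by positivity)
      _ ≤ N := h3
  · calc c.2 ≤ c.2 ^ 3 := Nat.le_self_pow (by norm_num) _
      _ ≤ c.1 ^ 2 * c.2 ^ 3 := Nat.le_mul_of_pos_left _ (by positivity)
      _ ≤ N := h3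

lemma sq_mul_cube_le_iff_fst {a b y : ℝ} (ha : 0 < a) (hb : 0 < b) (hy : 0 < y) :
    a ^ 2 * b ^ 3 ≤ y ↔ a ≤ y ^ (1 / 2 : ℝ) * b ^ (-(3 / 2) : ℝ) := by
  have e : (y ^ (1 / 2 : ℝ) * b ^ (-(3 / 2) : ℝ)) ^ 2 * b ^ 3 = y := by
    rw [mul_pow, ← Real.rpow_natCast, ← Real.rpow_natCast, ← Real.rpow_natCast,
      ← Real.rpow_mul hy.le, ← Real.rpow_mul hb.le, mul_assoc, ← Real.rpow_add hb]
    norm_num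
  conv_lhs => rhs; rw [← e]
  rw [mul_le_mul_iff_left₀ (by positivity), pow_le_pow_iff_left₀ ha.le (by positivity) (by norm_num)]

lemma sq_mul_cube_le_iff_snd {a b y : ℝ} (ha : 0 < a) (hb : 0 < b) (hy : 0 < y) :
    a ^ 2 * b ^ 3 ≤ y ↔ b ≤ y ^ (1 / 3 : ℝ) * a ^ (-(2 / 3) : ℝ) := by
  have e : a ^ 2 * (y ^ (1 / 3 : ℝ) * a ^ (-(2 / 3) : ℝ)) ^ 3 = y := by
    rw [mul_pow, ← Real.rpow_natCast, ← Real.rpow_natCast, ← Real.rpow_natCast,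
      ← Real.rpow_mul hy.le, ← Real.rpow_mul ha.le, mul_left_comm, ← Real.rpow_add ha]
    norm_num
  conv_lhs => rhs; rw [← e]
  rw [mul_le_mul_iff_right₀ (by positivity), pow_le_pow_iff_left₀ hb.le (by positivity) (by norm_num)]

lemma card_Icc_one_eq (n : ℕ) : (Icc 1 n).card = n := by simp

lemma mem_sqCubePairs_floor {y : ℝ} (hy : 0 ≤ y) {c : ℕ × ℕ} :
    c ∈ sqCubePairs ⌊y⌋₊ ↔ 0 < c.1 ∧ 0 < c.2 ∧ (c.1 : ℝ) ^ 2 * (c.2 : ℝ) ^ 3 ≤ y := by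
  rw [mem_sqCubePairs, Nat.le_floor_iff hy]
  push_cast
  rfl

/-- Dirichlet's hyperbola method for `sqCubePairs`. -/
lemma card_sqCubePairs_add_sq {y : ℝ} {K : ℕ} (hy : 0 < y) (hK : (K : ℝ) ^ 5 ≤ y)
    (hK' : y < (K + 1 : ℝ) ^ 5) :
    (sqCubePairs ⌊y⌋₊).card + K ^ 2 =
      ∑ n ∈ Icc 1 K, ⌊y ^ (1 / 2 : ℝ) * (n : ℝ) ^ (-(3 / 2) : ℝ)⌋₊ +
      ∑ n ∈ Icc 1 K, ⌊y ^ (1 / 3 : ℝ) * (n : ℝ) ^ (-(2 / 3) : ℝ)⌋₊ := by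
  set S := sqCubePairs ⌊y⌋₊ with hS
  have hmem (c : ℕ × ℕ) : c ∈ S ↔ _ := mem_sqCubePairs_floor hy.le
  have hunion : S.filter (fun c => c.2 ≤ K) ∪ S.filter (fun c => c.1 ≤ K) = S := by
    rw [← filter_or, filter_true_of_mem]
    intro c hc
    by_contra! h
    obtain ⟨-, -, h3⟩ := (hmem c).1 hc
    have h1 : (K + 1 : ℝ) ≤ c.1 := by exact_mod_cast h.2
    have h2 : (K + 1 : ℝ) ≤ c.2 := by exact_mod_cast h.1
    have : (K + 1 : ℝ) ^ 5 ≤ (c.1 : ℝ) ^ 2 * (c.2 : ℝ) ^ 3 := by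
      calc (K + 1 : ℝ) ^ 5 = (K + 1 : ℝ) ^ 2 * (K + 1 : ℝ) ^ 3 := by ring
        _ ≤ _ := by gcongr
    linarith
  have hinter : S.filter (fun c => c.2 ≤ K) ∩ S.filter (fun c => c.1 ≤ K) =
      Icc 1 K ×ˢ Icc 1 K := by
    ext c
    simp only [mem_inter, mem_filter, mem_product, mem_Icc, hmem]
    constructor
    · rintro ⟨⟨h, h2⟩, -, h1⟩
      exact ⟨⟨h.1, h1⟩, h.2.1, h2⟩
    · rintro ⟨⟨h1, h2⟩, h3, h4⟩
      have : (c.1 : ℝ) ^ 2 * (c.2 : ℝ) ^ 3 ≤ y := by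
        have g1 : (c.1 : ℝ) ≤ K := by exact_mod_cast h2
        have g2 : (c.2 : ℝ) ≤ K := by exact_mod_cast h4
        calc (c.1 : ℝ) ^ 2 * (c.2 : ℝ) ^ 3 ≤ (K : ℝ) ^ 2 * (K : ℝ) ^ 3 := by gcongr
          _ = (K : ℝ) ^ 5 := by ring
          _ ≤ y := hK
      exact ⟨⟨⟨h1, h3, this⟩, h4⟩, ⟨h1, h3, this⟩, h2⟩
  have hfst : (S.filter (fun c => c.2 ≤ K)).card =
      ∑ n ∈ Icc 1 K, ⌊y ^ (1 / 2 : ℝ) * (n : ℝ) ^ (-(3 / 2) : ℝ)⌋₊ := by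
    rw [card_eq_sum_card_fiberwise (f := Prod.snd) (t := Icc 1 K)]
    · refine sum_congr rfl fun n hn => ?_
      have hn0 : 0 < n := (mem_Icc.1 hn).1
      have hn0' : (0 : ℝ) < n := by exact_mod_cast hn0
      rw [← card_Icc_one_eq ⌊_⌋₊]
      refine card_nbij' Prod.fst (fun a => (a, n)) ?_ ?_ ?_ ?_
      · rintro ⟨a, b⟩ h
        simp only [coe_filter, Set.mem_ofPred_eq, mem_filter, hmem] at h
        obtain ⟨⟨⟨h1, -, h3⟩, -⟩, rfl⟩ := h
        simp only [coe_Icc, Set.mem_Icc]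
        exact ⟨h1, Nat.le_floor ((sq_mul_cube_le_iff_fst (by exact_mod_cast h1) hn0' hy).1 h3)⟩
      · intro a h
        simp only [coe_Icc, Set.mem_Icc] at h
        simp only [coe_filter, Set.mem_ofPred_eq, mem_filter, hmem]
        exact ⟨⟨⟨h.1, hn0, (sq_mul_cube_le_iff_fst (by exact_mod_cast h.1) hn0' hy).2
          ((Nat.le_floor_iff (by positivity)).1 h.2)⟩, (mem_Icc.1 hn).2⟩, trivial⟩
      · rintro ⟨a, b⟩ h
        simp only [coe_filter, Set.mem_ofPred_eq, mem_filter] at h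
        simp [h.2]
      · intro a _
        rfl
    · intro c hc
      simp only [coe_filter, Set.mem_ofPred_eq, hmem] at hc
      simp only [coe_Icc, Set.mem_Icc]
      exact ⟨hc.1.2.1, hc.2⟩
  have hsnd : (S.filter (fun c => c.1 ≤ K)).card =
      ∑ n ∈ Icc 1 K, ⌊y ^ (1 / 3 : ℝ) * (n : ℝ) ^ (-(2 / 3) : ℝ)⌋₊ := by
    rw [card_eq_sum_card_fiberwise (f := Prod.fst) (t := Icc 1 K)]
    · refine sum_congr rfl fun n hn => ?_
      have hn0 : 0 < n := (mem_Icc.1 hn).1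
      have hn0' : (0 : ℝ) < n := by exact_mod_cast hn0
      rw [← card_Icc_one_eq ⌊_⌋₊]
      refine card_nbij' Prod.snd (fun b => (n, b)) ?_ ?_ ?_ ?_
      · rintro ⟨a, b⟩ h
        simp only [coe_filter, Set.mem_ofPred_eq, mem_filter, hmem] at h
        obtain ⟨⟨⟨-, h2, h3⟩, -⟩, rfl⟩ := h
        simp only [coe_Icc, Set.mem_Icc]
        exact ⟨h2, Nat.le_floor ((sq_mul_cube_le_iff_snd hn0' (by exact_mod_cast h2) hy).1 h3)⟩
      · intro b h
        simp only [coe_Icc, Set.mem_Icc] at h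
        simp only [coe_filter, Set.mem_ofPred_eq, mem_filter, hmem]
        exact ⟨⟨⟨hn0, h.1, (sq_mul_cube_le_iff_snd hn0' (by exact_mod_cast h.1) hy).2
          ((Nat.le_floor_iff (by positivity)).1 h.2)⟩, (mem_Icc.1 hn).2⟩, trivial⟩
      · rintro ⟨a, b⟩ h
        simp only [coe_filter, Set.mem_ofPred_eq, mem_filter] at h
        simp [h.2]
      · intro b _
        rfl
    · intro c hc
      simp only [coe_filter, Set.mem_ofPred_eq, hmem] at hc
      simp only [coe_Icc, Set.mem_Icc]
      exact ⟨hc.1.1, hc.2⟩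
  rw [← hfst, ← hsnd, ← card_union_add_card_inter, hunion, hinter, card_product]
  simp [sq]

lemma natFloor_eq_sub_sawtooth {t : ℝ} (ht : 0 ≤ t) : (⌊t⌋₊ : ℝ) = t - sawtooth t - 1 / 2 := by
  rw [natCast_floor_eq_intCast_floor ht, sawtooth, Int.fract]
  ring

lemma abs_hyperbola_boundary_le {k t : ℝ} (hk : 1 ≤ k) (ht1 : 1 ≤ t) (ht : t ≤ 1 + 1 / k) :
    |k ^ 2 * (-2 * t ^ 3 + 3 * t ^ 2 - 1) + k / 2 * (t ^ 3 + t ^ 2 - 2)| ≤ 10 := by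
  have hk0 : 0 < k := by linarith
  have hku : k * (t - 1) ≤ 1 := by
    calc k * (t - 1) ≤ k * (1 / k) := by
          gcongr
          linarith
      _ = 1 := by field_simp
  have hku0 : 0 ≤ k * (t - 1) := mul_nonneg hk0.le (by linarith)
  have ht2 : t ≤ 2 := by
    have : 1 / k ≤ 1 := by rw [div_le_one hk0]; exact hk
    linarith
  set u := k * (t - 1) with hu
  have e : k ^ 2 * (-2 * t ^ 3 + 3 * t ^ 2 - 1) + k / 2 * (t ^ 3 + t ^ 2 - 2) =
      u * (t ^ 2 + 2 * t + 2) / 2 - u ^ 2 * (2 * t + 1) := by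
    rw [hu]; ring
  have b1 : u * (t ^ 2 + 2 * t + 2) ≤ 1 * (2 ^ 2 + 2 * 2 + 2) := by gcongr
  have b2 : u ^ 2 * (2 * t + 1) ≤ 1 ^ 2 * (2 * 2 + 1) := by gcongr
  have b3 : 0 ≤ u * (t ^ 2 + 2 * t + 2) := by positivity
  have b4 : 0 ≤ u ^ 2 * (2 * t + 1) := by positivity
  rw [e, abs_le]
  constructor <;> linarith

lemma sum_natFloor_eq (K : ℕ) {f : ℕ → ℝ} (hf : ∀ n, 0 ≤ f n) :
    ((∑ n ∈ Icc 1 K, ⌊f n⌋₊ : ℕ) : ℝ) =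
      ∑ n ∈ Icc 1 K, f n - ∑ n ∈ Icc 1 K, sawtooth (f n) - K / 2 := by
  push_cast
  rw [sum_congr rfl fun n _ => natFloor_eq_sub_sawtooth (hf n), sum_sub_distrib, sum_sub_distrib]
  simp [div_eq_mul_inv]

lemma exists_card_sqCubePairs_bound_of_one_le :
    ∃ z₁ z₂ : ℝ, riemannZeta (3 / 2) = z₁ ∧ riemannZeta (2 / 3) = z₂ ∧ ∃ C : ℝ, 0 < C ∧
      ∀ y : ℝ, 1 ≤ y →
        |((sqCubePairs ⌊y⌋₊).card : ℝ) - z₁ * y ^ (1 / 2 : ℝ) - z₂ * y ^ (1 / 3 : ℝ)| ≤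
          C * y ^ (1 / 6 : ℝ) := by
  obtain ⟨z₁, hz₁, C₁, hC₁, h₁⟩ := exists_zeta_partial_sum_bound (s := 3 / 2) (by norm_num)
    (by norm_num)
  obtain ⟨z₂, hz₂, C₂, hC₂, h₂⟩ := exists_zeta_partial_sum_bound (s := 2 / 3) (by norm_num)
    (by norm_num)
  obtain ⟨C₃, hC₃, h₃⟩ := exists_sum_sawtooth_bound (e := 1 / 2) (s := 3 / 2) (by norm_num)
    (by norm_num) (by norm_num) (by norm_num) (by norm_num)
  obtain ⟨C₄, hC₄, h₄⟩ := exists_sum_sawtooth_bound (e := 1 / 3) (s := 2 / 3) (by norm_num)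
    (by norm_num) (by norm_num) (by norm_num) (by norm_num)
  refine ⟨z₁, z₂, by rw [← hz₁]; norm_num, by rw [← hz₂]; norm_num,
    8 * C₁ + 4 * C₂ + C₃ + C₄ + 10, by positivity, fun y hy => ?_⟩
  have hy0 : 0 < y := by linarith
  have hy5 : 1 ≤ y ^ (1 / 5 : ℝ) := Real.one_le_rpow hy (by norm_num)
  have e5 : (y ^ (1 / 5 : ℝ)) ^ 5 = y := by
    rw [← Real.rpow_natCast, ← Real.rpow_mul hy0.le]
    norm_num
  obtain ⟨K, hKdef⟩ : ∃ K, K = ⌊y ^ (1 / 5 : ℝ)⌋₊ := ⟨_, rfl⟩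
  have hK : 0 < K := hKdef ▸ Nat.floor_pos.2 hy5
  have hK1 : (1 : ℝ) ≤ K := by exact_mod_cast hK
  have hK0 : (0 : ℝ) < K := by linarith
  have hKy : (K : ℝ) ^ 5 ≤ y := by
    calc (K : ℝ) ^ 5 ≤ (y ^ (1 / 5 : ℝ)) ^ 5 := by
          gcongr
          rw [hKdef]
          exact Nat.floor_le (by positivity)
      _ = y := e5
  have hyK : y < (K + 1 : ℝ) ^ 5 := by
    calc y = (y ^ (1 / 5 : ℝ)) ^ 5 := e5.symm
      _ < _ := by
        gcongr
        rw [hKdef]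
        exact Nat.lt_floor_add_one _
  have hcount := congrArg (Nat.cast : ℕ → ℝ) (card_sqCubePairs_add_sq hy0 hKy hyK)
  rw [Nat.cast_add, Nat.cast_add, sum_natFloor_eq K (fun n => by positivity),
    sum_natFloor_eq K (fun n => by positivity), ← mul_sum, ← mul_sum] at hcount
  obtain ⟨t, ht⟩ : ∃ t, t = (y / (K : ℝ) ^ 5) ^ (1 / 6 : ℝ) := ⟨_, rfl⟩
  have hyK0 : 0 ≤ y / (K : ℝ) ^ 5 := by positivity
  have ht1 : 1 ≤ t := by
    rw [ht]
    exact Real.one_le_rpow (by rwa [le_div_iff₀ (by positivity), one_mul]) (by norm_num)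
  have ht6 : t ^ 6 = y / (K : ℝ) ^ 5 := by
    rw [ht, ← Real.rpow_natCast, ← Real.rpow_mul hyK0]
    norm_num
  have htK : t ≤ 1 + 1 / K := by
    have hb : (1 : ℝ) ≤ 1 + 1 / K := by
      have : (0 : ℝ) ≤ 1 / K := by positivity
      linarith
    refine le_of_pow_le_pow_left₀ (by norm_num : 6 ≠ 0) (by positivity) ?_
    calc t ^ 6 = y / (K : ℝ) ^ 5 := ht6
      _ ≤ (K + 1 : ℝ) ^ 5 / (K : ℝ) ^ 5 := by gcongr
      _ = (1 + 1 / (K : ℝ)) ^ 5 := by field_simp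
      _ ≤ (1 + 1 / (K : ℝ)) ^ 6 := pow_le_pow_right₀ hb (by norm_num)
  have ht2 : t ≤ 2 := by
    have : (1 : ℝ) / K ≤ 1 := by rwa [div_le_one hK0]
    linarith
  have hrpow (r : ℝ) : y ^ r = t ^ (6 * r) * (K : ℝ) ^ (5 * r) := by
    have : y = t ^ (6 : ℝ) * (K : ℝ) ^ (5 : ℝ) := by
      have := (eq_div_iff (by positivity)).1 ht6
      rw [← this]
      norm_cast
    rw [this, Real.mul_rpow (by positivity) (by positivity), ← Real.rpow_mul (by positivity),
      ← Real.rpow_mul (by positivity)]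
  have hA (r : ℝ) : y ^ (1 / 2 : ℝ) * (K : ℝ) ^ r = t ^ 3 * (K : ℝ) ^ (5 / 2 + r) := by
    rw [hrpow, mul_assoc, ← Real.rpow_add hK0, ← Real.rpow_natCast]
    norm_num
  have hB (r : ℝ) : y ^ (1 / 3 : ℝ) * (K : ℝ) ^ r = t ^ 2 * (K : ℝ) ^ (5 / 3 + r) := by
    rw [hrpow, mul_assoc, ← Real.rpow_add hK0, ← Real.rpow_natCast]
    norm_num
  have hK2 : (K : ℝ) ^ (2 : ℝ) = (K : ℝ) ^ 2 := by norm_cast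
  have A1 : y ^ (1 / 2 : ℝ) * (K : ℝ) ^ (1 - 3 / 2 : ℝ) = t ^ 3 * (K : ℝ) ^ 2 := by
    rw [hA, ← hK2]; norm_num
  have A2 : y ^ (1 / 2 : ℝ) * (K : ℝ) ^ (-(3 / 2) : ℝ) = t ^ 3 * K := by
    rw [hA]; norm_num
  have A3 : y ^ (1 / 2 : ℝ) * (K : ℝ) ^ (-(3 / 2) - 1 : ℝ) = t ^ 3 := by
    rw [hA]; norm_num
  have B1 : y ^ (1 / 3 : ℝ) * (K : ℝ) ^ (1 - 2 / 3 : ℝ) = t ^ 2 * (K : ℝ) ^ 2 := by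
    rw [hB, ← hK2]; norm_num
  have B2 : y ^ (1 / 3 : ℝ) * (K : ℝ) ^ (-(2 / 3) : ℝ) = t ^ 2 * K := by
    rw [hB]; norm_num
  have B3 : y ^ (1 / 3 : ℝ) * (K : ℝ) ^ (-(2 / 3) - 1 : ℝ) = t ^ 2 := by
    rw [hB]; norm_num
  have hy2 : 0 ≤ y ^ (1 / 2 : ℝ) := by positivity
  have hy3 : 0 ≤ y ^ (1 / 3 : ℝ) := by positivity
  have b₁ := mul_le_mul_of_nonneg_left (h₁ K hK) hy2
  have b₂ := mul_le_mul_of_nonneg_left (h₂ K hK) hy3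
  have c₁ : y ^ (1 / 2 : ℝ) * (C₁ * (K : ℝ) ^ (-(3 / 2) - 1 : ℝ)) ≤ 8 * C₁ := by
    calc y ^ (1 / 2 : ℝ) * (C₁ * (K : ℝ) ^ (-(3 / 2) - 1 : ℝ)) = t ^ 3 * C₁ := by rw [← A3]; ring
      _ ≤ 2 ^ 3 * C₁ := by gcongr
      _ = 8 * C₁ := by norm_num
  have c₂ : y ^ (1 / 3 : ℝ) * (C₂ * (K : ℝ) ^ (-(2 / 3) - 1 : ℝ)) ≤ 4 * C₂ := by
    calc y ^ (1 / 3 : ℝ) * (C₂ * (K : ℝ) ^ (-(2 / 3) - 1 : ℝ)) = t ^ 2 * C₂ := by rw [← B3]; ring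
      _ ≤ 2 ^ 2 * C₂ := by gcongr
      _ = 4 * C₂ := by norm_num
  have b₃ := h₃ y K hK hKy
  have b₄ := h₄ y K hK hKy
  have b₅ := abs_hyperbola_boundary_le hK1 ht1 htK
  have b₆ : 1 ≤ y ^ (1 / 6 : ℝ) := Real.one_le_rpow hy (by norm_num)
  set σ₁ := ∑ n ∈ Icc 1 K, (n : ℝ) ^ (-(3 / 2) : ℝ)
  set σ₂ := ∑ n ∈ Icc 1 K, (n : ℝ) ^ (-(2 / 3) : ℝ)
  set τ₁ := ∑ n ∈ Icc 1 K, sawtooth (y ^ (1 / 2 : ℝ) * (n : ℝ) ^ (-(3 / 2) : ℝ))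
  set τ₂ := ∑ n ∈ Icc 1 K, sawtooth (y ^ (1 / 3 : ℝ) * (n : ℝ) ^ (-(2 / 3) : ℝ))
  rw [← abs_of_nonneg hy2, ← abs_mul, abs_of_nonneg hy2] at b₁
  rw [← abs_of_nonneg hy3, ← abs_mul, abs_of_nonneg hy3] at b₂
  have e₁ : y ^ (1 / 2 : ℝ) * (σ₁ - z₁ - (K : ℝ) ^ (1 - 3 / 2 : ℝ) / (1 - 3 / 2)
      - (K : ℝ) ^ (-(3 / 2) : ℝ) / 2) =
      y ^ (1 / 2 : ℝ) * σ₁ - z₁ * y ^ (1 / 2 : ℝ) + 2 * (t ^ 3 * (K : ℝ) ^ 2) - t ^ 3 * K / 2 := by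
    rw [← A1, ← A2]; ring
  have e₂ : y ^ (1 / 3 : ℝ) * (σ₂ - z₂ - (K : ℝ) ^ (1 - 2 / 3 : ℝ) / (1 - 2 / 3)
      - (K : ℝ) ^ (-(2 / 3) : ℝ) / 2) =
      y ^ (1 / 3 : ℝ) * σ₂ - z₂ * y ^ (1 / 3 : ℝ) - 3 * (t ^ 2 * (K : ℝ) ^ 2) - t ^ 2 * K / 2 := by
    rw [← B1, ← B2]; ring
  rw [e₁] at b₁
  rw [e₂] at b₂
  have f₁ := abs_le.1 (b₁.trans c₁)
  have f₂ := abs_le.1 (b₂.trans c₂)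
  have f₃ := abs_le.1 b₃
  have f₄ := abs_le.1 b₄
  have f₅ := abs_le.1 b₅
  have g₁ : 8 * C₁ ≤ 8 * C₁ * y ^ (1 / 6 : ℝ) := le_mul_of_one_le_right (by positivity) b₆
  have g₂ : 4 * C₂ ≤ 4 * C₂ * y ^ (1 / 6 : ℝ) := le_mul_of_one_le_right (by positivity) b₆
  push_cast at hcount
  rw [abs_le]
  constructor <;> linarith

/-- Asymptotics for the number of pairs of positive integers with `a ^ 2 * b ^ 3 ≤ y`. -/
lemma exists_card_sqCubePairs_bound :
    ∃ z₁ z₂ : ℝ, riemannZeta (3 / 2) = z₁ ∧ riemannZeta (2 / 3) = z₂ ∧ ∃ C : ℝ, 0 < C ∧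
      ∀ r : ℝ, 1 / 6 ≤ r → r ≤ 1 / 3 → ∀ y : ℝ, 0 < y →
        |((sqCubePairs ⌊y⌋₊).card : ℝ) - z₁ * y ^ (1 / 2 : ℝ) - z₂ * y ^ (1 / 3 : ℝ)| ≤
          C * y ^ r := by
  obtain ⟨z₁, z₂, hz₁, hz₂, C, hC, h⟩ := exists_card_sqCubePairs_bound_of_one_le
  refine ⟨z₁, z₂, hz₁, hz₂, C + |z₁| + |z₂|, by positivity, fun r hr hr' y hy => ?_⟩
  have hyr : 0 ≤ y ^ r := by positivity
  rcases le_or_gt 1 y with hy1 | hy1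
  · refine (h y hy1).trans ?_
    have h1 : y ^ (1 / 6 : ℝ) ≤ y ^ r := Real.rpow_le_rpow_of_exponent_le hy1 hr
    have h2 : C ≤ C + |z₁| + |z₂| := by
      have := abs_nonneg z₁
      have := abs_nonneg z₂
      linarith
    gcongr
  · have h0 : sqCubePairs ⌊y⌋₊ = ∅ := by
      rw [Nat.floor_eq_zero.2 hy1]
      rfl
    have h1 : y ^ (1 / 2 : ℝ) ≤ y ^ r :=
      Real.rpow_le_rpow_of_exponent_ge hy hy1.le (by linarith)
    have h2 : y ^ (1 / 3 : ℝ) ≤ y ^ r := Real.rpow_le_rpow_of_exponent_ge hy hy1.le hr'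
    rw [h0, card_empty, Nat.cast_zero, zero_sub]
    calc |-(z₁ * y ^ (1 / 2 : ℝ)) - z₂ * y ^ (1 / 3 : ℝ)|
        ≤ |-(z₁ * y ^ (1 / 2 : ℝ))| + |z₂ * y ^ (1 / 3 : ℝ)| := abs_sub _ _
      _ = |z₁| * y ^ (1 / 2 : ℝ) + |z₂| * y ^ (1 / 3 : ℝ) := by
        rw [abs_neg, abs_mul, abs_mul, abs_of_nonneg (by positivity : 0 ≤ y ^ (1 / 2 : ℝ)),
          abs_of_nonneg (by positivity : 0 ≤ y ^ (1 / 3 : ℝ))]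
      _ ≤ |z₁| * y ^ r + |z₂| * y ^ r := by gcongr
      _ ≤ (C + |z₁| + |z₂|) * y ^ r := by
        have := mul_nonneg hC.le hyr
        linarith

open Classical in
lemma card_filter_dvd_sqCubePairs {u v : ℕ} (hu : 0 < u) (hv : 0 < v) (P : ℕ × ℕ → Prop) (N : ℕ) :
    ((sqCubePairs N).filter fun c => u ∣ c.1 ∧ v ∣ c.2 ∧ P c).card =
      ((sqCubePairs (N / (u ^ 2 * v ^ 3))).filter fun c => P (u * c.1, v * c.2)).card := by
  have key (a b : ℕ) : (u * a) ^ 2 * (v * b) ^ 3 ≤ N ↔ a ^ 2 * b ^ 3 ≤ N / (u ^ 2 * v ^ 3) := by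
    rw [Nat.le_div_iff_mul_le (by positivity)]
    ring_nf
  symm
  refine card_bij (fun c _ => (u * c.1, v * c.2)) ?_ ?_ ?_
  · rintro ⟨a, b⟩ h
    simp only [mem_filter, mem_sqCubePairs] at h ⊢
    exact ⟨⟨Nat.mul_pos hu h.1.1, Nat.mul_pos hv h.1.2.1, (key a b).2 h.1.2.2⟩,
      dvd_mul_right _ _, dvd_mul_right _ _, h.2⟩
  · rintro ⟨a, b⟩ - ⟨a', b'⟩ - h
    simp only [Prod.mk.injEq] at h ⊢
    exact ⟨Nat.eq_of_mul_eq_mul_left hu h.1, Nat.eq_of_mul_eq_mul_left hv h.2⟩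
  · rintro ⟨a, b⟩ h
    simp only [mem_filter, mem_sqCubePairs] at h
    obtain ⟨⟨h1, h2, h3⟩, ⟨a, rfl⟩, ⟨b, rfl⟩, hP⟩ := h
    refine ⟨(a, b), ?_, rfl⟩
    simp only [mem_filter, mem_sqCubePairs]
    exact ⟨⟨Nat.pos_of_mul_pos_left h1, Nat.pos_of_mul_pos_left h2, (key a b).1 h3⟩, hP⟩

/-- The pairs in `sqCubePairs N` both of whose entries are prime to `p`. -/
def sqCubePairsPrimeTo (p N : ℕ) : Finset (ℕ × ℕ) :=
  (sqCubePairs N).filter fun c => ¬ p ∣ c.1 ∧ ¬ p ∣ c.2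

lemma card_sqCubePairsPrimeTo {p : ℕ} (hp : 0 < p) (N : ℕ) :
    ((sqCubePairsPrimeTo p N).card : ℤ) = (sqCubePairs N).card - (sqCubePairs (N / p ^ 2)).card
      - (sqCubePairs (N / p ^ 3)).card + (sqCubePairs (N / p ^ 5)).card := by
  have h1 := card_filter_dvd_sqCubePairs hp one_pos (fun _ => True) N
  have h2 := card_filter_dvd_sqCubePairs one_pos hp (fun _ => True) N
  have h3 := card_filter_dvd_sqCubePairs hp hp (fun _ => True) N
  simp only [one_dvd, one_pow, mul_one, one_mul, and_true, true_and, filter_true,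
    ← pow_add, Nat.reduceAdd] at h1 h2 h3
  rw [← h1, ← h2, ← h3, sqCubePairsPrimeTo]
  have e1 := card_filter_add_card_filter_not (s := sqCubePairs N) (fun c => p ∣ c.1 ∨ p ∣ c.2)
  have e2 := card_union_add_card_inter ((sqCubePairs N).filter fun c => p ∣ c.1)
    ((sqCubePairs N).filter fun c => p ∣ c.2)
  rw [← filter_or, ← filter_and] at e2
  simp only [not_or] at e1
  omega

lemma card_filter_sq_dvd_sqCubePairsPrimeTo {p d : ℕ} (hp : p.Prime) (hd : 0 < d) (hpd : ¬ p ∣ d)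
    (N : ℕ) : ((sqCubePairsPrimeTo p N).filter fun c => d ^ 2 ∣ c.2).card =
      (sqCubePairsPrimeTo p (N / d ^ 6)).card := by
  classical
  have h := card_filter_dvd_sqCubePairs one_pos (pow_pos hd 2) (fun c => ¬ p ∣ c.1 ∧ ¬ p ∣ c.2) N
  have hpd2 : ¬ p ∣ d ^ 2 := fun h => hpd (hp.dvd_of_dvd_pow h)
  simp only [one_dvd, one_pow, one_mul, true_and, ← pow_mul, Nat.reduceMul, hp.dvd_mul, hpd2,
    false_or] at h
  rw [sqCubePairsPrimeTo, sqCubePairsPrimeTo, filter_filter, ← h]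
  congr 1
  ext c
  simp only [mem_filter]
  tauto

lemma sq_dvd_sq_mul_iff_of_squarefree {d e s : ℕ} (hs : Squarefree s) (he : 0 < e) :
    d ^ 2 ∣ e ^ 2 * s ↔ d ∣ e := by
  refine ⟨fun h => ?_, fun h => (pow_dvd_pow_of_dvd h 2).mul_right s⟩
  have hs0 : s ≠ 0 := hs.ne_zero
  rcases Nat.eq_zero_or_pos d with rfl | hd
  · rw [zero_pow two_ne_zero, zero_dvd_iff] at h
    exact absurd h (mul_ne_zero (by positivity) hs0)
  rw [← Nat.factorization_le_iff_dvd hd.ne' he.ne']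
  intro q
  have h1 := (Nat.factorization_le_iff_dvd (by positivity) (mul_ne_zero (by positivity) hs0)).2 h q
  rw [Nat.factorization_mul (by positivity) hs0, Nat.factorization_pow, Nat.factorization_pow] at h1
  simp only [Finsupp.smul_apply, Finsupp.add_apply, smul_eq_mul] at h1
  have h2 := hs.natFactorization_le_one q
  omega

open ArithmeticFunction ArithmeticFunction.Moebius ArithmeticFunction.zeta in
open Classical in
lemma sum_moebius_sq_dvd {b N : ℕ} (hb : 0 < b) (hbN : b ≤ N) :
    ∑ d ∈ (Icc 1 N).filter (fun d => d ^ 2 ∣ b), μ d = if Squarefree b then 1 else 0 := by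
  obtain ⟨s, e, hs, he, rfl, hsq⟩ := Nat.sq_mul_squarefree_of_pos hb
  have h1 : (Icc 1 N).filter (fun d => d ^ 2 ∣ e ^ 2 * s) = e.divisors := by
    ext d
    simp only [mem_filter, mem_Icc, Nat.mem_divisors, sq_dvd_sq_mul_iff_of_squarefree hsq he]
    refine ⟨fun h => ⟨h.2, he.ne'⟩, fun h => ⟨⟨Nat.pos_of_dvd_of_pos h.1 he, ?_⟩, h.1⟩⟩
    calc d ≤ e := Nat.le_of_dvd he h.1
      _ ≤ e ^ 2 := Nat.le_self_pow two_ne_zero e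
      _ ≤ e ^ 2 * s := Nat.le_mul_of_pos_right _ hs
      _ ≤ N := hbN
  rw [h1, ← coe_mul_zeta_apply, moebius_mul_coe_zeta, one_apply]
  refine if_congr ⟨?_, fun h => ?_⟩ rfl rfl
  · rintro rfl
    simpa using hsq
  · exact Nat.isUnit_iff.1 (h e ⟨s, by ring⟩)

lemma squarefull_iff_exists {m : ℕ} (hm : 0 < m) :
    Squarefull m ↔ ∃ a b, 0 < a ∧ Squarefree b ∧ m = a ^ 2 * b ^ 3 := by
  constructor
  · intro h
    obtain ⟨s, e, hs, he, rfl, hsq⟩ := Nat.sq_mul_squarefree_of_pos hm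
    have hse : s ∣ e := by
      rw [← Nat.factorization_le_iff_dvd hs.ne' he.ne']
      intro q
      rcases Nat.eq_zero_or_pos (s.factorization q) with h0 | h0
      · rw [h0]; exact Nat.zero_le _
      · have hq : q.Prime := Nat.prime_of_mem_primeFactors
          (Nat.support_factorization s ▸ Finsupp.mem_support_iff.2 h0.ne')
        have hqm := h q hq ((Nat.dvd_of_factorization_pos h0.ne').mul_left _)
        rw [hq.pow_dvd_iff_le_factorization hm.ne', Nat.factorization_mul (by positivity) hs.ne',
          Nat.factorization_pow] at hqm
        simp only [Finsupp.smul_apply, Finsupp.add_apply, smul_eq_mul] at hqm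
        have h2 := hsq.natFactorization_le_one q
        omega
    obtain ⟨k, rfl⟩ := hse
    exact ⟨k, s, Nat.pos_of_mul_pos_left he, hsq, by ring⟩
  · rintro ⟨a, b, -, -, rfl⟩ q hq hdvd
    rcases hq.dvd_mul.1 hdvd with h | h
    · exact (pow_dvd_pow_of_dvd (hq.dvd_of_dvd_pow h) 2).mul_right _
    · exact ((pow_dvd_pow_of_dvd (hq.dvd_of_dvd_pow h) 2).trans
        (pow_dvd_pow b (by norm_num))).mul_left _

lemma sq_mul_cube_injective {a b a' b' : ℕ} (ha : 0 < a) (ha' : 0 < a') (hb : Squarefree b)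
    (hb' : Squarefree b') (h : a ^ 2 * b ^ 3 = a' ^ 2 * b' ^ 3) : a = a' ∧ b = b' := by
  have hb0 := hb.ne_zero
  have hb0' := hb'.ne_zero
  have hf (q : ℕ) : 2 * a.factorization q + 3 * b.factorization q =
      2 * a'.factorization q + 3 * b'.factorization q := by
    have := congrArg (fun n => n.factorization q) h
    simpa [Nat.factorization_mul, Nat.factorization_pow, ha.ne', ha'.ne', hb0, hb0'] using this
  have h1 (q : ℕ) := hb.natFactorization_le_one q
  have h2 (q : ℕ) := hb'.natFactorization_le_one q
  constructor
  · refine Nat.eq_of_factorization_eq ha.ne' ha'.ne' fun q => ?_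
    have := hf q; have := h1 q; have := h2 q
    omega
  · refine Nat.eq_of_factorization_eq hb0 hb0' fun q => ?_
    have := hf q; have := h1 q; have := h2 q
    omega

open Classical in
lemma card_squarefull_coprime_eq {p : ℕ} (hp : p.Prime) (N : ℕ) :
    ((Icc 1 N).filter fun m => Squarefull m ∧ m.Coprime p).card =
      ((sqCubePairsPrimeTo p N).filter fun c => Squarefree c.2).card := by
  have hcop (a b : ℕ) : (a ^ 2 * b ^ 3).Coprime p ↔ ¬ p ∣ a ∧ ¬ p ∣ b := by
    rw [Nat.coprime_comm, hp.coprime_iff_not_dvd, hp.dvd_mul, not_or,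
      hp.prime.dvd_pow_iff_dvd two_ne_zero, hp.prime.dvd_pow_iff_dvd three_ne_zero]
  symm
  refine card_bij (fun c _ => c.1 ^ 2 * c.2 ^ 3) ?_ ?_ ?_
  · rintro ⟨a, b⟩ h
    simp only [mem_filter, sqCubePairsPrimeTo, mem_sqCubePairs] at h
    obtain ⟨⟨⟨h1, h2, h3⟩, h4⟩, h5⟩ := h
    simp only [mem_filter, mem_Icc]
    have h0 : 0 < a ^ 2 * b ^ 3 := by positivity
    exact ⟨⟨h0, h3⟩, (squarefull_iff_exists h0).2 ⟨a, b, h1, h5, rfl⟩, (hcop a b).2 h4⟩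
  · rintro ⟨a, b⟩ h ⟨a', b'⟩ h' e
    simp only [mem_filter, sqCubePairsPrimeTo, mem_sqCubePairs] at h h'
    exact Prod.ext_iff.2 (sq_mul_cube_injective h.1.1.1 h'.1.1.1 h.2 h'.2 e)
  · intro m hm
    simp only [mem_filter, mem_Icc] at hm
    obtain ⟨⟨h1, h2⟩, h3, h4⟩ := hm
    obtain ⟨a, b, ha, hb, rfl⟩ := (squarefull_iff_exists h1).1 h3
    refine ⟨(a, b), ?_, rfl⟩
    simp only [mem_filter, sqCubePairsPrimeTo, mem_sqCubePairs]
    exact ⟨⟨⟨ha, Nat.pos_of_ne_zero hb.ne_zero, h2⟩, (hcop a b).1 h4⟩, hb⟩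

open ArithmeticFunction ArithmeticFunction.Moebius in
open Classical in
/-- The number of square-full integers up to `N` prime to `p`, as a Möbius sum. -/
lemma card_squarefull_coprime_eq_sum_moebius {p : ℕ} (hp : p.Prime) (N : ℕ) :
    (((Icc 1 N).filter fun m => Squarefull m ∧ m.Coprime p).card : ℤ) =
      ∑ d ∈ Icc 1 N, (if p ∣ d then 0 else μ d) * (sqCubePairsPrimeTo p (N / d ^ 6)).card := by
  rw [card_squarefull_coprime_eq hp, card_filter, Nat.cast_sum]
  have h1 : ∀ c ∈ sqCubePairsPrimeTo p N, (((if Squarefree c.2 then 1 else 0 : ℕ)) : ℤ) =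
      ∑ d ∈ Icc 1 N, if d ^ 2 ∣ c.2 then μ d else 0 := by
    intro c hc
    simp only [sqCubePairsPrimeTo, sqCubePairs, mem_filter, mem_product, mem_Icc] at hc
    rw [← sum_filter, sum_moebius_sq_dvd hc.1.1.2.1 hc.1.1.2.2]
    push_cast
    rfl
  rw [sum_congr rfl h1, sum_comm]
  refine sum_congr rfl fun d hd => ?_
  rw [← sum_filter, sum_const, nsmul_eq_mul, mul_comm]
  split_ifs with h
  · rw [filter_false_of_mem, card_empty, Nat.cast_zero, mul_zero, zero_mul]
    intro c hc h'
    simp only [sqCubePairsPrimeTo, mem_filter] at hc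
    exact hc.2.2 ((h.trans (Dvd.intro_left _ (sq d).symm)).trans h')
  · rw [card_filter_sq_dvd_sqCubePairsPrimeTo hp (mem_Icc.1 hd).1 h]

open ArithmeticFunction ArithmeticFunction.Moebius LSeries in
lemma hasSum_moebius_prime_to {p : ℕ} (hp : p.Prime) {k : ℕ} (hk : 2 ≤ k) :
    HasSum (fun d : ℕ => ((if p ∣ d then 0 else μ d : ℤ) : ℂ) * ((d : ℂ) ^ k)⁻¹)
      ((1 - ((p : ℂ) ^ k)⁻¹) * riemannZeta k)⁻¹ := by
  have : NeZero p := ⟨hp.ne_zero⟩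
  have hk1 : 1 < (k : ℂ).re := by
    rw [Complex.natCast_re]
    exact_mod_cast hk
  have hk2 : (k : ℂ) ≠ 1 := by
    intro h
    simp [h] at hk1
  set χ : DirichletCharacter ℂ p := 1 with hχ
  have hsum : LSeriesSummable ((fun n : ℕ => χ n) * fun n : ℕ => ((μ n : ℤ) : ℂ)) k :=
    DirichletCharacter.LSeriesSummable_mul χ (LSeriesSummable_moebius_iff.2 hk1)
  have hL : LSeries (fun n : ℕ => χ n) k = (1 - ((p : ℂ) ^ k)⁻¹) * riemannZeta k := by
    rw [← DirichletCharacter.LFunction_eq_LSeries χ hk1]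
    refine (DirichletCharacter.LFunctionTrivChar_eq_mul_riemannZeta hk2).trans ?_
    rw [hp.primeFactors, prod_singleton, Complex.cpow_neg, Complex.cpow_natCast]
  have hinv := DirichletCharacter.LSeries.mul_mu_eq_one χ hk1
  rw [hL] at hinv
  rw [← eq_inv_of_mul_eq_one_right hinv]
  have hterm : (fun d : ℕ => ((if p ∣ d then 0 else μ d : ℤ) : ℂ) * ((d : ℂ) ^ k)⁻¹) =
      LSeries.term ((fun n : ℕ => χ n) * fun n : ℕ => ((μ n : ℤ) : ℂ)) k := by
    ext d
    rcases eq_or_ne d 0 with rfl | hd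
    · simp
    rw [LSeries.term_of_ne_zero hd, Complex.cpow_natCast, div_eq_mul_inv, Pi.mul_apply, hχ]
    congr 1
    split_ifs with h
    · have : ¬ IsUnit (d : ZMod p) := by
        rw [ZMod.isUnit_iff_coprime, Nat.coprime_comm, hp.coprime_iff_not_dvd]
        exact not_not.2 h
      rw [MulChar.map_nonunit _ this, zero_mul, Int.cast_zero]
    · have : IsUnit (d : ZMod p) := by
        rwa [ZMod.isUnit_iff_coprime, Nat.coprime_comm, hp.coprime_iff_not_dvd]
      rw [MulChar.one_apply this, one_mul]
  rw [hterm]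
  exact hsum.hasSum

lemma exists_card_sqCubePairsPrimeTo_bound :
    ∃ z₁ z₂ : ℝ, riemannZeta (3 / 2) = z₁ ∧ riemannZeta (2 / 3) = z₂ ∧ ∃ C : ℝ, 0 < C ∧
      ∀ r : ℝ, 1 / 6 ≤ r → r ≤ 1 / 3 → ∀ p : ℕ, 0 < p → ∀ y : ℝ, 0 < y →
        |((sqCubePairsPrimeTo p ⌊y⌋₊).card : ℝ)
          - z₁ * ((1 - (p : ℝ)⁻¹) * (1 - (p : ℝ) ^ (-(3 / 2) : ℝ))) * y ^ (1 / 2 : ℝ)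
          - z₂ * ((1 - (p : ℝ)⁻¹) * (1 - (p : ℝ) ^ (-(2 / 3) : ℝ))) * y ^ (1 / 3 : ℝ)| ≤
          C * y ^ r := by
  obtain ⟨z₁, z₂, hz₁, hz₂, C, hC, h⟩ := exists_card_sqCubePairs_bound
  refine ⟨z₁, z₂, hz₁, hz₂, 4 * C, by positivity, fun r hr hr' p hp y hy => ?_⟩
  have hp1 : (1 : ℝ) ≤ p := by exact_mod_cast hp
  have hp0 : (0 : ℝ) < p := by linarith
  have hdiv (k : ℕ) (s : ℝ) : (y / (p : ℝ) ^ k) ^ s = y ^ s * (p : ℝ) ^ (-(k * s)) := by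
    rw [Real.div_rpow hy.le (by positivity), ← Real.rpow_natCast, ← Real.rpow_mul hp0.le,
      Real.rpow_neg hp0.le, div_eq_mul_inv]
  have hk (k : ℕ) : |((sqCubePairs (⌊y⌋₊ / p ^ k)).card : ℝ)
      - z₁ * (y ^ (1 / 2 : ℝ) * (p : ℝ) ^ (-(k * (1 / 2)) : ℝ))
      - z₂ * (y ^ (1 / 3 : ℝ) * (p : ℝ) ^ (-(k * (1 / 3)) : ℝ))| ≤ C * y ^ r := by
    have h1 := h r hr hr' (y / (p : ℝ) ^ k) (by positivity)
    rw [hdiv, hdiv] at h1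
    have h2 : ⌊y / (p : ℝ) ^ k⌋₊ = ⌊y⌋₊ / p ^ k := by
      rw [← Nat.floor_div_natCast]
      push_cast
      rfl
    rw [h2] at h1
    refine h1.trans ?_
    gcongr
    exact div_le_self hy.le (one_le_pow₀ hp1)
  have h0 := hk 0
  have h2 := hk 2
  have h3 := hk 3
  have h5 := hk 5
  have e1 : (p : ℝ) ^ (-((5 : ℕ) * (1 / 2)) : ℝ) = (p : ℝ)⁻¹ * (p : ℝ) ^ (-(3 / 2) : ℝ) := by
    rw [← Real.rpow_neg_one, ← Real.rpow_add hp0]; norm_num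
  have e2 : (p : ℝ) ^ (-((5 : ℕ) * (1 / 3)) : ℝ) = (p : ℝ)⁻¹ * (p : ℝ) ^ (-(2 / 3) : ℝ) := by
    rw [← Real.rpow_neg_one, ← Real.rpow_add hp0]; norm_num
  have e3 : (p : ℝ) ^ (-((2 : ℕ) * (1 / 2)) : ℝ) = (p : ℝ)⁻¹ := by
    rw [← Real.rpow_neg_one]; norm_num
  have e4 : (p : ℝ) ^ (-((3 : ℕ) * (1 / 3)) : ℝ) = (p : ℝ)⁻¹ := by
    rw [← Real.rpow_neg_one]; norm_num
  have e5 : (p : ℝ) ^ (-((2 : ℕ) * (1 / 3)) : ℝ) = (p : ℝ) ^ (-(2 / 3) : ℝ) := by norm_num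
  have e6 : (p : ℝ) ^ (-((3 : ℕ) * (1 / 2)) : ℝ) = (p : ℝ) ^ (-(3 / 2) : ℝ) := by norm_num
  rw [e1, e2] at h5
  rw [e3, e5] at h2
  rw [e4, e6] at h3
  simp only [pow_zero, Nat.div_one, Nat.cast_zero, zero_mul, neg_zero, Real.rpow_zero,
    mul_one] at h0
  have hcard := congrArg (Int.cast : ℤ → ℝ) (card_sqCubePairsPrimeTo hp ⌊y⌋₊)
  push_cast at hcard
  rw [hcard]
  rw [abs_le] at h0 h2 h3 h5 ⊢
  constructor <;> linarith

open ArithmeticFunction ArithmeticFunction.Moebius in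
lemma norm_moebius_prime_to_le_one (p d : ℕ) :
    ‖((if p ∣ d then 0 else μ d : ℤ) : ℂ)‖ ≤ 1 := by
  split_ifs
  · simp
  · rw [Complex.norm_intCast]
    exact_mod_cast abs_moebius_le_one

open ArithmeticFunction ArithmeticFunction.Moebius in
open Classical in
/-- The count of square-full integers prime to `p` up to `x`, with main terms given as multiples of
Dirichlet series of the Möbius function. -/
lemma exists_card_squarefull_coprime_bound {r : ℝ} (hr : 1 / 6 < r) (hr' : r ≤ 1 / 3) :
    ∃ z₁ z₂ : ℝ, riemannZeta (3 / 2) = z₁ ∧ riemannZeta (2 / 3) = z₂ ∧ ∃ C : ℝ, 0 < C ∧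
      ∀ p : ℕ, p.Prime → ∀ x : ℝ, 0 < x →
        ‖((((Icc 1 ⌊x⌋₊).filter fun m => Squarefull m ∧ m.Coprime p).card : ℕ) : ℂ)
          - ((z₁ * ((1 - (p : ℝ)⁻¹) * (1 - (p : ℝ) ^ (-(3 / 2) : ℝ))) * x ^ (1 / 2 : ℝ) : ℝ) : ℂ)
            * ((1 - ((p : ℂ) ^ 3)⁻¹) * riemannZeta 3)⁻¹
          - ((z₂ * ((1 - (p : ℝ)⁻¹) * (1 - (p : ℝ) ^ (-(2 / 3) : ℝ))) * x ^ (1 / 3 : ℝ) : ℝ) : ℂ)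
            * ((1 - ((p : ℂ) ^ 2)⁻¹) * riemannZeta 2)⁻¹‖ ≤ C * x ^ r := by
  obtain ⟨z₁, z₂, hz₁, hz₂, C, hC, h⟩ := exists_card_sqCubePairsPrimeTo_bound
  have hsum : Summable fun d : ℕ => (d : ℝ) ^ (-(6 * r)) :=
    Real.summable_nat_rpow.2 (by linarith)
  have hsum0 : 0 ≤ ∑' d : ℕ, (d : ℝ) ^ (-(6 * r)) := tsum_nonneg fun d => by positivity
  refine ⟨z₁, z₂, hz₁, hz₂, C * (∑' d : ℕ, (d : ℝ) ^ (-(6 * r)) + 1), by positivity,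
    fun p hp x hx => ?_⟩
  set A := z₁ * ((1 - (p : ℝ)⁻¹) * (1 - (p : ℝ) ^ (-(3 / 2) : ℝ))) with hA
  set B := z₂ * ((1 - (p : ℝ)⁻¹) * (1 - (p : ℝ) ^ (-(2 / 3) : ℝ))) with hB
  set w : ℕ → ℤ := fun d => if p ∣ d then 0 else μ d with hw
  set F : ℕ → ℕ := fun d => (sqCubePairsPrimeTo p (⌊x⌋₊ / d ^ 6)).card with hF
  have hcount : HasSum (fun d => (w d : ℂ) * F d)
      ((((Icc 1 ⌊x⌋₊).filter fun m => Squarefull m ∧ m.Coprime p).card : ℕ) : ℂ) := by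
    have h1 := congrArg (Int.cast : ℤ → ℂ) (card_squarefull_coprime_eq_sum_moebius hp ⌊x⌋₊)
    push_cast at h1
    have h2 : HasSum (fun d => (w d : ℂ) * F d) (∑ d ∈ Icc 1 ⌊x⌋₊, (w d : ℂ) * F d) := by
      refine hasSum_sum_of_ne_finset_zero fun d hd => ?_
      rcases Nat.eq_zero_or_pos d with rfl | hd0
      · simp [hw]
      · have hlt : ⌊x⌋₊ < d ^ 6 := by
          have : ⌊x⌋₊ < d := by
            by_contra! h'
            exact hd (mem_Icc.2 ⟨hd0, h'⟩)
          exact this.trans_le (Nat.le_self_pow (by norm_num) d)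
        have : F d = 0 := by
          rw [hF]
          simp only [Nat.div_eq_of_lt hlt]
          rfl
        rw [this, Nat.cast_zero, mul_zero]
    rw [h1]
    simpa only [hw, hF, Int.cast_ite, Int.cast_zero] using h2
  have h3 := (hasSum_moebius_prime_to hp (by norm_num : 2 ≤ 3)).mul_left
    ((A * x ^ (1 / 2 : ℝ) : ℝ) : ℂ)
  have h2 := (hasSum_moebius_prime_to hp (le_refl 2)).mul_left ((B * x ^ (1 / 3 : ℝ) : ℝ) : ℂ)
  have htot := (hcount.sub h3).sub h2
  have hbound : HasSum (fun d : ℕ => C * x ^ r * (d : ℝ) ^ (-(6 * r)))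
      (C * x ^ r * ∑' d : ℕ, (d : ℝ) ^ (-(6 * r))) := hsum.hasSum.mul_left _
  have hle (d : ℕ) : ‖(w d : ℂ) * F d - ((A * x ^ (1 / 2 : ℝ) : ℝ) : ℂ) * (w d * ((d : ℂ) ^ 3)⁻¹)
      - ((B * x ^ (1 / 3 : ℝ) : ℝ) : ℂ) * (w d * ((d : ℂ) ^ 2)⁻¹)‖ ≤
      C * x ^ r * (d : ℝ) ^ (-(6 * r)) := by
    rcases Nat.eq_zero_or_pos d with rfl | hd
    · simp only [hw, dvd_zero, if_true, Int.cast_zero, zero_mul, mul_zero, sub_zero, norm_zero]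
      positivity
    have hd0 : (0 : ℝ) < d := by exact_mod_cast hd
    have hdiv (s : ℝ) : (x / (d : ℝ) ^ 6) ^ s = x ^ s * (d : ℝ) ^ (-(6 * s)) := by
      rw [Real.div_rpow hx.le (by positivity), ← Real.rpow_natCast, ← Real.rpow_mul hd0.le,
        Real.rpow_neg hd0.le, div_eq_mul_inv]
      norm_num
    have hy := h r hr.le hr' p hp.pos (x / (d : ℝ) ^ 6) (by positivity)
    have hfl : ⌊x / (d : ℝ) ^ 6⌋₊ = ⌊x⌋₊ / d ^ 6 := by
      rw [← Nat.floor_div_natCast]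
      push_cast
      rfl
    have e1 : (d : ℝ) ^ (-(6 * (1 / 2)) : ℝ) = ((d : ℝ) ^ 3)⁻¹ := by
      rw [Real.rpow_neg hd0.le]
      norm_num
    have e2 : (d : ℝ) ^ (-(6 * (1 / 3)) : ℝ) = ((d : ℝ) ^ 2)⁻¹ := by
      rw [Real.rpow_neg hd0.le]
      norm_num
    rw [hfl, hdiv, hdiv, hdiv, e1, e2] at hy
    have e : (w d : ℂ) * F d - ((A * x ^ (1 / 2 : ℝ) : ℝ) : ℂ) * (w d * ((d : ℂ) ^ 3)⁻¹)
        - ((B * x ^ (1 / 3 : ℝ) : ℝ) : ℂ) * (w d * ((d : ℂ) ^ 2)⁻¹) =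
        w d * (((F d : ℝ) - A * (x ^ (1 / 2 : ℝ) * ((d : ℝ) ^ 3)⁻¹)
          - B * (x ^ (1 / 3 : ℝ) * ((d : ℝ) ^ 2)⁻¹) : ℝ) : ℂ) := by
      push_cast
      ring
    rw [e, norm_mul, Complex.norm_real, Real.norm_eq_abs]
    calc ‖(w d : ℂ)‖ * |(F d : ℝ) - A * (x ^ (1 / 2 : ℝ) * ((d : ℝ) ^ 3)⁻¹)
          - B * (x ^ (1 / 3 : ℝ) * ((d : ℝ) ^ 2)⁻¹)|
        ≤ 1 * (C * (x ^ r * (d : ℝ) ^ (-(6 * r)))) :=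
          mul_le_mul (norm_moebius_prime_to_le_one p d) hy (abs_nonneg _) zero_le_one
      _ = _ := by ring
  have hfin := tsum_of_norm_bounded hbound hle
  rw [htot.tsum_eq] at hfin
  refine hfin.trans ?_
  have : 0 ≤ C * x ^ r := by positivity
  linarith

end SquarefullCount

open Classical in
/-- Principal character case of Lemma 2: the number of square-full integers `m ≤ x` coprime to
`p` is `(L(3/2,χ₀)/ζ(3)) (1 + 1/p + 1/p²)⁻¹ x^(1/2) + (ζ(2/3)/ζ(2)) ((1-p^(-2/3))/(1+p⁻¹)) x^(1/3)
+ O(x^(1/6+ε) p^ε)`, where `L(3/2,χ₀) = ζ(3/2)(1 - p^(-3/2))`. -/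
theorem squarefull_count_coprime_asymptotic :
    ∀ ε : ℝ, 0 < ε → ∃ C : ℝ, 0 < C ∧ ∀ (p : ℕ) [Fact p.Prime], Odd p → ∀ x : ℝ, 2 ≤ x →
      ∃ E : ℂ,
        ((((Finset.Icc 1 ⌊x⌋₊).filter (fun m => Squarefull m ∧ Nat.Coprime m p)).card : ℕ) : ℂ)
          = (riemannZeta (3/2) * (1 - (p : ℂ) ^ (-(3/2 : ℂ)))) / riemannZeta 3
              * ((1 + 1 / (p : ℝ) + 1 / (p : ℝ) ^ 2)⁻¹ : ℝ) * ((x ^ ((1 : ℝ)/2) : ℝ) : ℂ)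
            + riemannZeta (2/3) / riemannZeta 2
              * (((1 - (p : ℝ) ^ (-(2/3 : ℝ))) / (1 + (p : ℝ)⁻¹) : ℝ) : ℂ)
              * ((x ^ ((1 : ℝ)/3) : ℝ) : ℂ)
            + E
        ∧ ‖E‖ ≤ C * x ^ ((1 : ℝ)/6 + ε) * (p : ℝ) ^ ε := by
  intro ε hε
  have hr : 1 / 6 < 1 / 6 + min ε (1 / 6) := by
    have := lt_min hε (by norm_num : (0 : ℝ) < 1 / 6)
    linarith
  have hr' : 1 / 6 + min ε (1 / 6) ≤ 1 / 3 := by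
    have := min_le_right ε (1 / 6)
    linarith
  obtain ⟨z₁, z₂, hz₁, hz₂, C, hC, h⟩ := exists_card_squarefull_coprime_bound hr hr'
  refine ⟨C, hC, fun p hpF _ x hx => ⟨_, (add_sub_cancel _ _).symm, ?_⟩⟩
  have hp := hpF.out
  have hp1 : (1 : ℝ) < p := by exact_mod_cast hp.one_lt
  have hp0 : (0 : ℝ) < p := by linarith
  have hbound := h p hp x (by linarith)
  have e₁ : (p : ℂ) ^ (-(3 / 2 : ℂ)) = (((p : ℝ) ^ (-(3 / 2) : ℝ) : ℝ) : ℂ) := by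
    rw [Complex.ofReal_cpow hp0.le]
    push_cast
    rfl
  have hζ3 : riemannZeta 3 ≠ 0 := riemannZeta_ne_zero_of_one_lt_re (by norm_num)
  have hζ2 : riemannZeta 2 ≠ 0 := riemannZeta_ne_zero_of_one_lt_re (by norm_num)
  have k₁ : (1 - (p : ℝ)⁻¹) * (1 - ((p : ℝ) ^ 3)⁻¹)⁻¹ = (1 + 1 / (p : ℝ) + 1 / (p : ℝ) ^ 2)⁻¹ := by
    have h1 : 1 - ((p : ℝ) ^ 3)⁻¹ = (1 - (p : ℝ)⁻¹) * (1 + 1 / (p : ℝ) + 1 / (p : ℝ) ^ 2) := by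
      field_simp
      ring
    have h2 : 1 - (p : ℝ)⁻¹ ≠ 0 := (sub_pos.2 (inv_lt_one_of_one_lt₀ hp1)).ne'
    rw [h1, mul_inv, mul_inv_cancel_left₀ h2]
  have k₂ : (1 - (p : ℝ)⁻¹) * (1 - ((p : ℝ) ^ 2)⁻¹)⁻¹ = (1 + (p : ℝ)⁻¹)⁻¹ := by
    have h1 : 1 - ((p : ℝ) ^ 2)⁻¹ = (1 - (p : ℝ)⁻¹) * (1 + (p : ℝ)⁻¹) := by
      field_simp
      ring
    have h2 : 1 - (p : ℝ)⁻¹ ≠ 0 := (sub_pos.2 (inv_lt_one_of_one_lt₀ hp1)).ne'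
    rw [h1, mul_inv, mul_inv_cancel_left₀ h2]
  have m₁ : ((z₁ * ((1 - (p : ℝ)⁻¹) * (1 - (p : ℝ) ^ (-(3 / 2) : ℝ))) * x ^ (1 / 2 : ℝ) : ℝ) : ℂ)
      * ((1 - ((p : ℂ) ^ 3)⁻¹) * riemannZeta 3)⁻¹ =
      (riemannZeta (3 / 2) * (1 - (p : ℂ) ^ (-(3 / 2 : ℂ)))) / riemannZeta 3
        * ((1 + 1 / (p : ℝ) + 1 / (p : ℝ) ^ 2)⁻¹ : ℝ) * ((x ^ ((1 : ℝ) / 2) : ℝ) : ℂ) := by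
    rw [← k₁, hz₁, e₁, mul_inv]
    push_cast
    ring
  have m₂ : ((z₂ * ((1 - (p : ℝ)⁻¹) * (1 - (p : ℝ) ^ (-(2 / 3) : ℝ))) * x ^ (1 / 3 : ℝ) : ℝ) : ℂ)
      * ((1 - ((p : ℂ) ^ 2)⁻¹) * riemannZeta 2)⁻¹ =
      riemannZeta (2 / 3) / riemannZeta 2
        * (((1 - (p : ℝ) ^ (-(2 / 3 : ℝ))) / (1 + (p : ℝ)⁻¹) : ℝ) : ℂ)
        * ((x ^ ((1 : ℝ) / 3) : ℝ) : ℂ) := by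
    rw [div_eq_mul_inv (1 - (p : ℝ) ^ (-(2 / 3 : ℝ))), ← k₂, hz₂, mul_inv]
    push_cast
    ring
  rw [m₁, m₂, sub_sub] at hbound
  refine hbound.trans ?_
  have hx1 : x ^ (1 / 6 + min ε (1 / 6)) ≤ x ^ ((1 : ℝ) / 6 + ε) :=
    Real.rpow_le_rpow_of_exponent_le (by linarith) (by gcongr; exact min_le_left _ _)
  have hpε : 1 ≤ (p : ℝ) ^ ε := Real.one_le_rpow hp1.le hε.le
  calc C * x ^ (1 / 6 + min ε (1 / 6)) ≤ C * x ^ ((1 : ℝ) / 6 + ε) := by gcongr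
    _ ≤ C * x ^ ((1 : ℝ) / 6 + ε) * (p : ℝ) ^ ε := by
      refine le_mul_of_one_le_right ?_ hpε
      have : 0 < x := by linarith
      positivity
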